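/- arXiv:2512.03325 — 2 statements merged into one kernel-verified Lean document; each statement's English description precedes it below -/
import Mathlib

section
/- Operator-norm bound for the matrix of degree-k Hermite features (Lemma F.2). Fix an integer k ≥ 1 and a constant D₀ > 0. There exist constants C, K, c > 0 depending only on k and D₀ such that for all n ≥ 1 and d ≥ 3: if x₁,…,x_n are i.i.d. N(0, I_d) and h_k(X) ∈ ℝ^{n×B_{d,k}} denotes the matrix whose i-th row is h_k(x_i)ᵀ, then with probability at least 1 − C·d^{−D₀} − C·n·e^{−cd}, one has ‖h_k(X)‖_op² ≤ (log d)^K · max(n, d^k). -/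
/-!
Operator-norm bound for the matrix of degree-`k` Hermite features (Lemma F.2).
-/

noncomputable section

open MeasureTheory ProbabilityTheory

/-- The degree-`k` orthonormal probabilist's Hermite polynomial. -/
def He (k : ℕ) (x : ℝ) : ℝ :=
  (Polynomial.aeval x (Polynomial.hermite k)) / Real.sqrt (Nat.factorial k)

/-- Multi-indices on `Fin d` of total degree `k`. -/
abbrev MIdx (d k : ℕ) : Type :=
  {κ : Fin d → ℕ // κ ∈ Finset.Nat.antidiagonalTuple d k}

/-- The vector `h_k(x)` of all degree-`k` multivariate Hermite polynomials. -/
def hvec (d k : ℕ) (x : Fin d → ℝ) : MIdx d k → ℝ :=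
  fun κ => ∏ i, He (κ.1 i) (x i)

/-- The standard Gaussian measure on `ι → ℝ`. -/
def stdG (ι : Type*) [Fintype ι] : Measure (ι → ℝ) :=
  Measure.pi fun _ => gaussianReal 0 1

/-- The `ℓ² → ℓ²` operator norm of a (rectangular) matrix, given as the supremum of
`‖A v‖₂` over vectors `v` with `‖v‖₂ ≤ 1`. -/
def opNorm {ι κ : Type*} [Fintype ι] [Fintype κ] (A : ι → κ → ℝ) : ℝ :=
  ⨆ v : {v : κ → ℝ // (∑ j, (v j) ^ 2) ≤ 1},
    Real.sqrt (∑ i, (∑ j, A i j * v.1 j) ^ 2)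


set_option linter.unusedSectionVars false
set_option linter.unusedSimpArgs false

section LA
open Matrix
variable {κ : Type*} [Fintype κ] [DecidableEq κ]

/-- quadratic form -/
def qf (h : κ → ℝ) (M : Matrix κ κ ℝ) : ℝ := h ⬝ᵥ (M *ᵥ h)

lemma qf_add (h : κ → ℝ) (M N : Matrix κ κ ℝ) : qf h (M + N) = qf h M + qf h N := by
  simp [qf, Matrix.add_mulVec, dotProduct_add]

lemma qf_smul (h : κ → ℝ) (c : ℝ) (M : Matrix κ κ ℝ) : qf h (c • M) = c * qf h M := by
  simp [qf, Matrix.smul_mulVec, dotProduct_smul]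

lemma qf_one (h : κ → ℝ) : qf h 1 = ∑ j, h j ^ 2 := by
  simp [qf, dotProduct, sq]

lemma qf_mul_rank (h : κ → ℝ) (M N : Matrix κ κ ℝ) :
    qf h (M * vecMulVec h h * N) = qf h M * qf h N := by
  simp only [qf]
  rw [← Matrix.mulVec_mulVec, ← Matrix.mulVec_mulVec, Matrix.vecMulVec_mulVec]
  simp [Matrix.mulVec_smul, dotProduct_smul, mul_comm]

lemma qf_nonneg {M : Matrix κ κ ℝ} (hM : M.PosSemidef) (h : κ → ℝ) : 0 ≤ qf h M := by
  have := hM.dotProduct_mulVec_nonneg h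
  simpa [qf] using this

lemma spectral_qf {S : Matrix κ κ ℝ} (hS : S.PosSemidef) (h : κ → ℝ) :
    ∃ w l : κ → ℝ, (∀ i, 0 ≤ w i) ∧ (∀ i, 0 ≤ l i) ∧
      ∀ P : Polynomial ℝ, qf h (Polynomial.aeval S P) = ∑ i, w i * P.eval (l i) := by
  set U := (hS.1.eigenvectorUnitary : Matrix κ κ ℝ) with hU
  set l := hS.1.eigenvalues with hl
  refine ⟨fun i => ((star U) *ᵥ h) i ^ 2, l, fun i => sq_nonneg _, hS.eigenvalues_nonneg, ?_⟩
  have hUU : star U * U = 1 := Unitary.coe_star_mul_self hS.1.eigenvectorUnitary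
  have hUU' : U * star U = 1 := Unitary.coe_mul_star_self hS.1.eigenvectorUnitary
  have hsp : S = U * diagonal l * star U := by
    have := hS.1.spectral_theorem
    rw [Unitary.conjStarAlgAut_apply] at this
    simpa using this
  have hpow : ∀ n : ℕ, S ^ n = U * diagonal (fun i => l i ^ n) * star U := by
    intro n
    induction n with
    | zero => simp [hUU']
    | succ n ih =>
      rw [pow_succ, ih]
      conv_lhs => rw [hsp]
      calc U * diagonal (fun i => l i ^ n) * star U * (U * diagonal l * star U)
          = U * diagonal (fun i => l i ^ n) * (star U * U) * diagonal l * star U := by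
            simp only [Matrix.mul_assoc]
        _ = _ := by
            rw [hUU, Matrix.mul_one, Matrix.mul_assoc U, diagonal_mul_diagonal]
            simp [pow_succ]
  have hq : ∀ n : ℕ, qf h (S ^ n) = ∑ i, ((star U) *ᵥ h) i ^ 2 * l i ^ n := by
    intro n
    rw [hpow, qf, ← Matrix.mulVec_mulVec, ← Matrix.mulVec_mulVec, Matrix.dotProduct_mulVec]
    have : h ᵥ* U = star U *ᵥ h := by
      rw [← Matrix.mulVec_transpose]; rfl
    rw [this]
    simp only [dotProduct, Matrix.mulVec_diagonal]
    exact Finset.sum_congr rfl fun i _ => by ring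
  intro P
  induction P using Polynomial.induction_on' with
  | add p q hp hq => 
    simp only [map_add, qf_add, hp, hq, Polynomial.eval_add, mul_add, Finset.sum_add_distrib]
  | monomial n a =>
    rw [Polynomial.aeval_monomial, ← Algebra.smul_def, qf_smul, hq, Finset.mul_sum]
    exact Finset.sum_congr rfl fun i _ => by simp; ring

lemma cheb {ι : Type*} [Fintype ι] (w f g : ι → ℝ) (hw : ∀ i, 0 ≤ w i)
    (hfg : ∀ i j, 0 ≤ (f i - f j) * (g i - g j)) :
    (∑ i, w i * f i) * (∑ i, w i * g i) ≤ (∑ i, w i) * ∑ i, w i * (f i * g i) := by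
  have h : 0 ≤ ∑ i, ∑ j, w i * w j * ((f i - f j) * (g i - g j)) :=
    Finset.sum_nonneg fun i _ => Finset.sum_nonneg fun j _ =>
      mul_nonneg (mul_nonneg (hw i) (hw j)) (hfg i j)
  have e : ∑ i, ∑ j, w i * w j * ((f i - f j) * (g i - g j)) =
      2 * ((∑ i, w i) * ∑ i, w i * (f i * g i)) - 2 * ((∑ i, w i * f i) * (∑ i, w i * g i)) := by
    have e1 : ∑ i, ∑ j, w i * w j * ((f i - f j) * (g i - g j)) =
      ∑ i, ∑ j, ((w i * (f i * g i)) * w j + w i * (w j * (f j * g j))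
        - (w i * f i) * (w j * g j) - (w i * g i) * (w j * f j)) :=
      Finset.sum_congr rfl fun i _ => Finset.sum_congr rfl fun j _ => by ring
    rw [e1]
    simp only [Finset.sum_sub_distrib, Finset.sum_add_distrib, ← Finset.sum_mul_sum]
    ring
  linarith

lemma qf_cheb {S : Matrix κ κ ℝ} (hS : S.PosSemidef) (h : κ → ℝ) (L : ℝ) (hL : 0 ≤ L) (a b : ℕ) :
    qf h (S ^ a) * qf h ((S + L • 1) ^ b) ≤
      (∑ j, h j ^ 2) * qf h (S ^ a * (S + L • 1) ^ b) := by
  obtain ⟨w, l, hw, hl, H⟩ := spectral_qf hS h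
  have h1 := H (Polynomial.X ^ a)
  have h2 := H ((Polynomial.X + Polynomial.C L) ^ b)
  have h3 := H (Polynomial.X ^ a * (Polynomial.X + Polynomial.C L) ^ b)
  have h4 := H 1
  simp only [map_pow, map_mul, map_add, Polynomial.aeval_X, Polynomial.aeval_C, map_one,
    Algebra.algebraMap_eq_smul_one, Polynomial.eval_pow, Polynomial.eval_mul, Polynomial.eval_add,
    Polynomial.eval_X, Polynomial.eval_C, Polynomial.eval_one, mul_one] at h1 h2 h3 h4
  rw [← qf_one, h1, h2, h3, h4]
  refine cheb w _ _ hw ?_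
  intro i j
  rcases le_total (l i) (l j) with hij | hij
  · apply mul_nonneg_of_nonpos_of_nonpos
    · exact sub_nonpos.2 (pow_le_pow_left₀ (hl i) hij a)
    · exact sub_nonpos.2 (pow_le_pow_left₀ (by linarith [hl i]) (by linarith) b)
  · apply mul_nonneg
    · exact sub_nonneg.2 (pow_le_pow_left₀ (hl j) hij a)
    · exact sub_nonneg.2 (pow_le_pow_left₀ (by linarith [hl j]) (by linarith) b)

lemma qf_mixed_nonneg {S : Matrix κ κ ℝ} (hS : S.PosSemidef) (h : κ → ℝ) (L : ℝ) (hL : 0 ≤ L)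
    (a b : ℕ) : 0 ≤ qf h (S ^ a * (S + L • 1) ^ b) := by
  obtain ⟨w, l, hw, hl, H⟩ := spectral_qf hS h
  have h3 := H (Polynomial.X ^ a * (Polynomial.X + Polynomial.C L) ^ b)
  simp only [map_pow, map_mul, map_add, Polynomial.aeval_X, Polynomial.aeval_C, map_one,
    Algebra.algebraMap_eq_smul_one, Polynomial.eval_pow, Polynomial.eval_mul, Polynomial.eval_add,
    Polynomial.eval_X, Polynomial.eval_C, Polynomial.eval_one, mul_one] at h3
  rw [h3]
  refine Finset.sum_nonneg fun i _ => ?_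
  have := hl i
  have := hw i
  positivity

lemma qf_rank_one_pow {S : Matrix κ κ ℝ} (hS : S.PosSemidef) (h : κ → ℝ) (L : ℝ)
    (hL : ∑ j, h j ^ 2 ≤ L) (b : ℕ) : ∀ a : ℕ,
    qf h (S ^ a * (S + vecMulVec h h) ^ b) ≤ qf h (S ^ a * (S + L • 1) ^ b) := by
  have hL0 : 0 ≤ L := le_trans (Finset.sum_nonneg fun i _ => sq_nonneg _) hL
  induction b with
  | zero => intro a; simp
  | succ b ih =>
    intro a
    have e1 : S ^ a * (S + vecMulVec h h) ^ (b+1) =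
        S ^ (a+1) * (S + vecMulVec h h) ^ b + S ^ a * vecMulVec h h * (S + vecMulVec h h) ^ b := by
      rw [pow_succ' _ b, pow_succ]; noncomm_ring
    have e2 : S ^ a * (S + L • 1) ^ (b+1) =
        S ^ (a+1) * (S + L • 1) ^ b + L • (S ^ a * (S + L • 1) ^ b) := by
      rw [pow_succ' _ b, pow_succ, add_mul, mul_add]; simp [Matrix.mul_assoc]
    rw [e1, e2, qf_add, qf_add, qf_mul_rank, qf_smul]
    have i1 := ih (a+1)
    have i2 := ih 0
    simp only [pow_zero, one_mul] at i2
    have c := qf_cheb hS h L hL0 a b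
    have n1 := qf_nonneg (hS.pow a) h
    have n2 := qf_mixed_nonneg hS h L hL0 a b
    have := mul_le_mul_of_nonneg_left i2 n1
    have := mul_le_mul_of_nonneg_right hL n2
    linarith

open scoped MatrixOrder Matrix.Norms.L2Operator in
lemma qf_le_trace {M : Matrix κ κ ℝ} (hM : M.PosSemidef) (v : κ → ℝ) (hv : ∑ j, v j ^ 2 ≤ 1) :
    qf v M ≤ M.trace := by
  obtain ⟨N, hN⟩ := CStarAlgebra.nonneg_iff_eq_star_mul_self.mp hM.nonneg
  rw [Matrix.star_eq_conjTranspose] at hN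
  subst hN
  have : qf v (Nᴴ * N) = ∑ i, (∑ j, N i j * v j) ^ 2 := by
    rw [qf, ← Matrix.mulVec_mulVec, Matrix.dotProduct_mulVec, Matrix.vecMul_conjTranspose]
    simp [dotProduct, Matrix.mulVec, sq]
  rw [this, Matrix.trace_mul_comm]
  simp only [trace, diag, Matrix.mul_apply, conjTranspose_apply, star_trivial]
  refine Finset.sum_le_sum fun i _ => ?_
  refine (Finset.sum_mul_sq_le_sq_mul_sq _ _ _).trans ?_
  have : 0 ≤ ∑ j, N i j ^ 2 := Finset.sum_nonneg fun _ _ => sq_nonneg _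
  calc _ ≤ (∑ j, N i j ^ 2) * 1 := mul_le_mul_of_nonneg_left hv this
    _ = _ := by simp [sq]

lemma qf_pow_le {S : Matrix κ κ ℝ} (hS : S.PosSemidef) (v : κ → ℝ) (hv : ∑ j, v j ^ 2 ≤ 1)
    (p : ℕ) : qf v S ^ (p+1) ≤ (S ^ (p+1)).trace := by
  refine le_trans ?_ (qf_le_trace (hS.pow _) v hv)
  induction p with
  | zero => simp
  | succ p ih =>
    have c := qf_cheb hS v 0 le_rfl 1 (p+1)
    simp only [zero_smul, add_zero, pow_one, ← pow_succ'] at c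
    have n1 := qf_nonneg hS v
    have n2 := qf_nonneg (hS.pow (p+2)) v
    calc _ = qf v S * qf v S ^ (p+1) := by ring
      _ ≤ qf v S * qf v (S ^ (p+1)) := mul_le_mul_of_nonneg_left ih n1
      _ ≤ _ := c
      _ ≤ 1 * qf v (S ^ (p+2)) := mul_le_mul_of_nonneg_right hv n2
      _ = _ := one_mul _

end LA

set_option linter.unusedSectionVars false

section MB
open Matrix
variable {κ : Type*} [Fintype κ] [DecidableEq κ]

lemma posSemidef_rank (h : κ → ℝ) : (vecMulVec h h).PosSemidef := by
  simpa using Matrix.posSemidef_vecMulVec_self_star h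

lemma qf_eq_sum (h : κ → ℝ) (M : Matrix κ κ ℝ) : qf h M = ∑ i, ∑ j, h i * h j * M i j := by
  simp only [qf, dotProduct, mulVec, Finset.mul_sum]
  exact Finset.sum_congr rfl fun i _ => Finset.sum_congr rfl fun j _ => by ring

lemma qf_eq_trace (h : κ → ℝ) (M : Matrix κ κ ℝ) : qf h M = (vecMulVec h h * M).trace := by
  rw [Matrix.trace_mul_comm, Matrix.mul_vecMulVec, Matrix.trace_vecMulVec, qf, dotProduct_comm]

variable {Ω : Type*}

/-- sum of rank-one matrices -/
def Sg (g : Ω → κ → ℝ) {n : ℕ} (ω : Fin n → Ω) : Matrix κ κ ℝ :=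
  ∑ i, vecMulVec (g (ω i)) (g (ω i))

lemma Sg_psd (g : Ω → κ → ℝ) {n : ℕ} (ω : Fin n → Ω) : (Sg g ω).PosSemidef :=
  Matrix.posSemidef_sum _ fun _ _ => posSemidef_rank _

lemma trace_Sg_pow (g : Ω → κ → ℝ) {n : ℕ} (ω : Fin n → Ω) (p : ℕ) :
    (Sg g ω ^ (p+1)).trace = ∑ i, qf (g (ω i)) (Sg g ω ^ p) := by
  rw [pow_succ']
  conv_lhs => enter [1, 1]; rw [Sg]
  rw [Finset.sum_mul, Matrix.trace_sum]
  exact Finset.sum_congr rfl fun i _ => (qf_eq_trace _ _).symm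

lemma Sg_succ (g : Ω → κ → ℝ) {n : ℕ} (ω : Fin (n+1) → Ω) (i : Fin (n+1)) :
    Sg g ω = Sg g (i.removeNth ω) + vecMulVec (g (ω i)) (g (ω i)) := by
  rw [Sg, Fin.sum_univ_succAbove _ i, add_comm]
  rfl

lemma measurable_pow_entry {α : Type*} [MeasurableSpace α] (M : α → Matrix κ κ ℝ)
    (hM : ∀ i j, Measurable fun a => M a i j) (p : ℕ) :
    ∀ i j, Measurable fun a => (M a ^ p) i j := by
  induction p with
  | zero => intro i j; simp
  | succ p ih =>
    intro i j
    simp only [pow_succ, Matrix.mul_apply]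
    exact Finset.measurable_sum _ fun l _ => (ih i l).mul (hM l j)

lemma trace_add_smul_pow (S : Matrix κ κ ℝ) (L : ℝ) (p : ℕ) :
    ((S + L • 1) ^ p).trace =
      ∑ j ∈ Finset.range (p+1), L ^ (p-j) * (p.choose j) * (S ^ j).trace := by
  have hc : Commute S (L • (1 : Matrix κ κ ℝ)) := by
    rw [commute_iff_eq]; simp
  rw [hc.add_pow, Matrix.trace_sum]
  refine Finset.sum_congr rfl fun j _ => ?_
  have : S ^ j * (L • (1 : Matrix κ κ ℝ)) ^ (p-j) * ((p.choose j : ℕ) : Matrix κ κ ℝ) =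
    (L ^ (p-j) * (p.choose j)) • S ^ j := by
    rw [smul_pow, one_pow, ← nsmul_eq_mul', mul_smul_comm, mul_one, ← Nat.cast_smul_eq_nsmul ℝ,
      smul_smul, mul_comm]
  rw [this, Matrix.trace_smul, smul_eq_mul]

variable [MeasurableSpace Ω]

lemma measurable_Sg (g : Ω → κ → ℝ) (hg : ∀ j, Measurable fun ω => g ω j) {n : ℕ} (i j : κ) :
    Measurable fun ω : Fin n → Ω => Sg g ω i j := by
  simp only [Sg, Matrix.sum_apply, vecMulVec_apply]
  exact Finset.measurable_sum _ fun l _ =>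
    ((hg i).comp (measurable_pi_apply l)).mul ((hg j).comp (measurable_pi_apply l))

lemma measurable_trace_Sg (g : Ω → κ → ℝ) (hg : ∀ j, Measurable fun ω => g ω j) {n : ℕ} (p : ℕ) :
    Measurable fun ω : Fin n → Ω => (Sg g ω ^ p).trace := by
  simp only [trace, diag]
  exact Finset.measurable_sum _ fun l _ => measurable_pow_entry _ (measurable_Sg g hg) p l l

theorem moment_bound (μ : Measure Ω) [IsProbabilityMeasure μ] (g : Ω → κ → ℝ)
    (hg : ∀ j, Measurable fun ω => g ω j) (L : ℝ) (hL0 : 0 ≤ L) (hL : ∀ ω, ∑ j, g ω j ^ 2 ≤ L)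
    (hM : ∀ M : Matrix κ κ ℝ, M.PosSemidef →
      ∫⁻ ω, ENNReal.ofReal (qf (g ω) M) ∂μ ≤ ENNReal.ofReal M.trace) :
    ∀ p n : ℕ, ∫⁻ ω, ENNReal.ofReal ((Sg g ω ^ p).trace) ∂(Measure.pi fun _ : Fin n => μ) ≤
      ENNReal.ofReal (Fintype.card κ * ((n : ℝ) + p * L) ^ p) := by
  intro p
  induction p using Nat.strong_induction_on with
  | _ p ih =>
  intro n
  rcases p with _ | p
  · simp
  rcases n with _ | n
  · have : ∀ ω : Fin 0 → Ω, (Sg g ω ^ (p+1)).trace = 0 := by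
      intro ω; rw [trace_Sg_pow]; simp
    simp [this]
  -- pointwise decomposition
  have hnn : ∀ ω : Fin (n+1) → Ω, ∀ i, 0 ≤ qf (g (ω i)) (Sg g ω ^ p) :=
    fun ω i => qf_nonneg ((Sg_psd g ω).pow p) _
  have hpsdL : ∀ y : Fin n → Ω, (Sg g y + L • (1 : Matrix κ κ ℝ)).PosSemidef := fun y =>
    (Sg_psd g y).add (Matrix.PosSemidef.one.smul hL0)
  have hmeasE : ∀ i j, Measurable fun y : Fin n → Ω => ((Sg g y + L • (1 : Matrix κ κ ℝ)) ^ p) i j := by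
    apply measurable_pow_entry
    intro i j
    simp only [Matrix.add_apply]
    exact (measurable_Sg g hg i j).add measurable_const
  have hFm : Measurable fun z : Ω × (Fin n → Ω) =>
      ENNReal.ofReal (qf (g z.1) ((Sg g z.2 + L • (1 : Matrix κ κ ℝ)) ^ p)) := by
    apply Measurable.ennreal_ofReal
    simp only [qf_eq_sum]
    refine Finset.measurable_sum _ fun i _ => Finset.measurable_sum _ fun j _ => ?_
    exact (((hg i).comp measurable_fst).mul ((hg j).comp measurable_fst)).mul
      ((hmeasE i j).comp measurable_snd)
  have hterm : ∀ i : Fin (n+1), ∫⁻ ω, ENNReal.ofReal (qf (g (ω i)) (Sg g ω ^ p))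
      ∂(Measure.pi fun _ : Fin (n+1) => μ) ≤
      ENNReal.ofReal (Fintype.card κ * ((n : ℝ) + 1 + (p+1) * L) ^ p) := by
    intro i
    calc ∫⁻ ω, ENNReal.ofReal (qf (g (ω i)) (Sg g ω ^ p)) ∂(Measure.pi fun _ : Fin (n+1) => μ)
        ≤ ∫⁻ ω, (fun z : Ω × (Fin n → Ω) =>
            ENNReal.ofReal (qf (g z.1) ((Sg g z.2 + L • (1 : Matrix κ κ ℝ)) ^ p)))
            (MeasurableEquiv.piFinSuccAbove (fun _ => Ω) i ω)
            ∂(Measure.pi fun _ : Fin (n+1) => μ) := by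
          refine lintegral_mono fun ω => ENNReal.ofReal_le_ofReal ?_
          have := qf_rank_one_pow (Sg_psd g (i.removeNth ω)) (g (ω i)) L (hL _) p 0
          rw [← Sg_succ] at this
          simpa using this
      _ = ∫⁻ z, ENNReal.ofReal (qf (g z.1) ((Sg g z.2 + L • (1 : Matrix κ κ ℝ)) ^ p))
            ∂(μ.prod (Measure.pi fun _ : Fin n => μ)) :=
          (measurePreserving_piFinSuccAbove (fun _ : Fin (n+1) => μ) i).lintegral_comp hFm
      _ = ∫⁻ y, ∫⁻ x, ENNReal.ofReal (qf (g x) ((Sg g y + L • (1 : Matrix κ κ ℝ)) ^ p)) ∂μ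
            ∂(Measure.pi fun _ : Fin n => μ) := lintegral_prod_symm' _ hFm
      _ ≤ ∫⁻ y, ENNReal.ofReal (((Sg g y + L • (1 : Matrix κ κ ℝ)) ^ p).trace)
            ∂(Measure.pi fun _ : Fin n => μ) :=
          lintegral_mono fun y => hM _ ((hpsdL y).pow p)
      _ = ∫⁻ y, ∑ j ∈ Finset.range (p+1), ENNReal.ofReal (L ^ (p-j) * (p.choose j)) *
            ENNReal.ofReal ((Sg g y ^ j).trace) ∂(Measure.pi fun _ : Fin n => μ) := by
          refine lintegral_congr fun y => ?_
          rw [trace_add_smul_pow, ENNReal.ofReal_sum_of_nonneg]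
          · refine Finset.sum_congr rfl fun j _ => ?_
            rw [ENNReal.ofReal_mul (by positivity)]
          · intro j _
            have := ((Sg_psd g y).pow j).trace_nonneg
            positivity
      _ = ∑ j ∈ Finset.range (p+1), ENNReal.ofReal (L ^ (p-j) * (p.choose j)) *
            ∫⁻ y, ENNReal.ofReal ((Sg g y ^ j).trace) ∂(Measure.pi fun _ : Fin n => μ) := by
          have hm : ∀ j, Measurable fun y : Fin n → Ω => ENNReal.ofReal ((Sg g y ^ j).trace) :=
            fun j => (measurable_trace_Sg g hg j).ennreal_ofReal
          rw [lintegral_finsetSum _ fun j _ => (hm j).const_mul _]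
          exact Finset.sum_congr rfl fun j _ => lintegral_const_mul _ (hm j)
      _ ≤ ∑ j ∈ Finset.range (p+1), ENNReal.ofReal (L ^ (p-j) * (p.choose j)) *
            ENNReal.ofReal (Fintype.card κ * ((n : ℝ) + p * L) ^ j) := by
          refine Finset.sum_le_sum fun j hj => ?_
          have hj' : j ≤ p := Nat.lt_succ_iff.1 (Finset.mem_range.1 hj)
          refine mul_le_mul_right ((ih j (by omega) n).trans (ENNReal.ofReal_le_ofReal ?_)) _
          gcongr
      _ = ENNReal.ofReal (Fintype.card κ * ((n : ℝ) + p * L + L) ^ p) := by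
          rw [add_pow, Finset.mul_sum, ENNReal.ofReal_sum_of_nonneg (fun j _ => by positivity)]
          refine Finset.sum_congr rfl fun j _ => ?_
          rw [← ENNReal.ofReal_mul (by positivity)]
          congr 1; ring
      _ ≤ _ := by
          apply ENNReal.ofReal_le_ofReal
          refine mul_le_mul_of_nonneg_left (pow_le_pow_left₀ (by positivity) (by linarith) p)
            (Nat.cast_nonneg _)
  calc _ = ∫⁻ ω, ∑ i, ENNReal.ofReal (qf (g (ω i)) (Sg g ω ^ p))
        ∂(Measure.pi fun _ : Fin (n+1) => μ) := by
        refine lintegral_congr fun ω => ?_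
        rw [trace_Sg_pow, ENNReal.ofReal_sum_of_nonneg fun i _ => hnn ω i]
    _ = ∑ i, ∫⁻ ω, ENNReal.ofReal (qf (g (ω i)) (Sg g ω ^ p))
        ∂(Measure.pi fun _ : Fin (n+1) => μ) := by
        refine lintegral_finsetSum _ fun i _ => ?_
        apply Measurable.ennreal_ofReal
        simp only [qf_eq_sum]
        refine Finset.measurable_sum _ fun a _ => Finset.measurable_sum _ fun b _ => ?_
        exact (((hg a).comp (measurable_pi_apply i)).mul ((hg b).comp (measurable_pi_apply i))).mul
          (measurable_pow_entry _ (measurable_Sg g hg) p a b)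
    _ ≤ ∑ i : Fin (n+1), ENNReal.ofReal (Fintype.card κ * ((n : ℝ) + 1 + (p+1) * L) ^ p) :=
        Finset.sum_le_sum fun i _ => hterm i
    _ = ENNReal.ofReal ((n+1) * (Fintype.card κ * ((n : ℝ) + 1 + (p+1) * L) ^ p)) := by
        rw [Finset.sum_const, Finset.card_univ, Fintype.card_fin, nsmul_eq_mul,
          ENNReal.ofReal_mul (p := (n : ℝ) + 1) (by positivity)]
        congr 1
        rw [← ENNReal.ofReal_natCast]
        push_cast
        rfl
    _ ≤ _ := by
        apply ENNReal.ofReal_le_ofReal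
        push_cast
        rw [pow_succ]
        have h1 : (n:ℝ) + 1 ≤ (n : ℝ) + 1 + (p+1) * L := by
          have : 0 ≤ ((p:ℝ)+1) * L := by positivity
          linarith
        have h2 : 0 ≤ (Fintype.card κ * ((n : ℝ) + 1 + (p+1) * L) ^ p) := by positivity
        nlinarith [mul_le_mul_of_nonneg_right h1 h2]

end MB

section HM
open Polynomial

lemma integrable_poly (P : ℝ[X]) : Integrable (fun x => P.eval x) (gaussianReal 0 1) := by
  have hX : ∀ n : ℕ, Integrable (fun x : ℝ => x ^ n) (gaussianReal 0 1) := by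
    intro n
    have := memLp_id_gaussianReal (μ := 0) (v := 1) (n : NNReal)
    have h2 := MemLp.integrable_norm_pow' (f := id) (p := n) (by simpa using this)
    refine h2.mono' (by fun_prop) (Filter.Eventually.of_forall fun x => ?_)
    simp
  simp only [eval_eq_sum_range]
  exact integrable_finsetSum _ fun i _ => (hX i).const_mul _

lemma integrable_pdf_poly (P : ℝ[X]) : Integrable (fun x => gaussianPDFReal 0 1 x * P.eval x) := by
  have h := integrable_poly P
  rw [gaussianReal_of_var_ne_zero _ one_ne_zero,
    integrable_withDensity_iff_integrable_smul' (measurable_gaussianPDF _ _)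
      (Filter.Eventually.of_forall fun x => gaussianPDF_lt_top)] at h
  simpa [toReal_gaussianPDF] using h

lemma hasDerivAt_pdf (x : ℝ) : HasDerivAt (gaussianPDFReal 0 1)
    (-(x * gaussianPDFReal 0 1 x)) x := by
  rw [gaussianPDFReal_def]
  have h1 : HasDerivAt (fun x : ℝ => -(x - 0) ^ 2 / (2 * ((1 : NNReal) : ℝ))) (-x) x := by
    have := ((hasDerivAt_id x).sub_const 0).pow 2
    have := (this.neg).div_const (2 * ((1 : NNReal) : ℝ))
    convert! this using 1
    simp
    ring
  have := (h1.exp).const_mul (√(2 * Real.pi * ((1 : NNReal) : ℝ)))⁻¹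
  convert! this using 1
  ring

lemma stein (P : ℝ[X]) : ∫ x, x * P.eval x ∂(gaussianReal 0 1) =
    ∫ x, (derivative P).eval x ∂(gaussianReal 0 1) := by
  rw [integral_gaussianReal_eq_integral_smul one_ne_zero,
    integral_gaussianReal_eq_integral_smul one_ne_zero]
  have i1 := integrable_pdf_poly (X * P)
  have i2 := integrable_pdf_poly (derivative P)
  have i3 := integrable_pdf_poly P
  have := integral_mul_deriv_eq_deriv_mul_of_integrable (u := fun x => P.eval x)
    (u' := fun x => (derivative P).eval x) (v := gaussianPDFReal 0 1)
    (v' := fun x => -(x * gaussianPDFReal 0 1 x)) (fun x _ => P.hasDerivAt x)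
    (fun x _ => hasDerivAt_pdf x)
    (by refine i1.neg.congr (Filter.Eventually.of_forall fun x => ?_); simp; ring)
    (by refine i2.congr (Filter.Eventually.of_forall fun x => ?_); simp; ring)
    (by refine i3.congr (Filter.Eventually.of_forall fun x => ?_); simp; ring)
  simp only [smul_eq_mul]
  have e1 : ∫ x, gaussianPDFReal 0 1 x * (x * P.eval x) =
      - ∫ x, P.eval x * -(x * gaussianPDFReal 0 1 x) := by
    rw [← integral_neg]
    exact integral_congr_ae (Filter.Eventually.of_forall fun x => by simp; ring)
  rw [e1, this, neg_neg]
  exact integral_congr_ae (Filter.Eventually.of_forall fun x => by simp; ring)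

/-- real Hermite polynomial -/
def HR (n : ℕ) : ℝ[X] := (hermite n).map (Int.castRingHom ℝ)

lemma HR_succ (n : ℕ) : HR (n+1) = X * HR n - derivative (HR n) := by
  simp [HR, hermite_succ, derivative_map]

lemma He_eq (n : ℕ) (x : ℝ) : He n x = (HR n).eval x / √(n.factorial) := by
  simp [He, HR, aeval_def, eval_map]

lemma integral_HR (n : ℕ) : ∀ P : ℝ[X], ∫ x, (HR n).eval x * P.eval x ∂(gaussianReal 0 1) =
    ∫ x, (derivative^[n] P).eval x ∂(gaussianReal 0 1) := by
  induction n with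
  | zero => intro P; simp [HR]
  | succ n ih =>
    intro P
    rw [Function.iterate_succ, Function.comp, ← ih]
    have s := stein (HR n * P)
    rw [derivative_mul] at s
    have e : ∀ x : ℝ, (HR (n+1)).eval x * P.eval x =
        x * (HR n * P).eval x - (derivative (HR n) * P).eval x := by
      intro x; simp [HR_succ]; ring
    simp only [e]
    rw [integral_sub _ (integrable_poly _), s]
    · rw [← integral_sub (integrable_poly _) (integrable_poly _)]
      simp
    · have := integrable_poly (X * (HR n * P))
      simp only [eval_mul, eval_X] at this ⊢
      exact this

lemma HR_orth (m n : ℕ) (h : m < n) : ∫ x, (HR n).eval x * (HR m).eval x ∂(gaussianReal 0 1) = 0 := by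
  rw [integral_HR, iterate_derivative_eq_zero]
  · simp
  · refine lt_of_le_of_lt (natDegree_map_le) ?_
    simpa using h

lemma HR_self (n : ℕ) : ∫ x, (HR n).eval x * (HR n).eval x ∂(gaussianReal 0 1) = n.factorial := by
  rw [integral_HR]
  have : derivative^[n] (HR n) = C (n.factorial : ℝ) := by
    ext m
    rw [coeff_iterate_derivative]
    rcases m with _ | m
    · simp [HR, coeff_map, Nat.descFactorial_self]
    · rw [HR, coeff_map, coeff_hermite_of_lt (by omega), coeff_C]
      simp
  rw [this]; simp

lemma He_orth (m n : ℕ) : ∫ x, He m x * He n x ∂(gaussianReal 0 1) = if m = n then 1 else 0 := by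
  have e : ∀ x, He m x * He n x =
      (√(m.factorial) * √(n.factorial))⁻¹ * ((HR m).eval x * (HR n).eval x) := by
    intro x; rw [He_eq, He_eq]; field_simp
  simp only [e]
  rw [integral_const_mul]
  split_ifs with h
  · subst h
    rw [HR_self, Real.mul_self_sqrt (by positivity)]
    exact inv_mul_cancel₀ (by positivity)
  · rcases lt_or_gt_of_ne h with h | h
    · simp only [mul_comm (eval _ (HR m))]
      rw [HR_orth _ _ h, mul_zero]
    · rw [HR_orth _ _ h, mul_zero]

lemma He_integrable (m n : ℕ) : Integrable (fun x => He m x * He n x) (gaussianReal 0 1) := by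
  have e : ∀ x, He m x * He n x =
      (√(m.factorial) * √(n.factorial))⁻¹ * ((HR m * HR n).eval x) := by
    intro x; rw [He_eq, He_eq, eval_mul]; field_simp
  simp only [e]
  exact (integrable_poly _).const_mul _

lemma He_measurable (m : ℕ) : Measurable (He m) := by
  have : He m = fun x => (HR m).eval x / √(m.factorial) := funext (He_eq m)
  rw [this]
  exact (HR m).continuous.measurable.div_const _

lemma hvec_mul (d k : ℕ) (a b : MIdx d k) (x : Fin d → ℝ) :
    hvec d k x a * hvec d k x b = ∏ i, (He (a.1 i) (x i) * He (b.1 i) (x i)) := by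
  simp [hvec, Finset.prod_mul_distrib]

lemma hvec_orth (d k : ℕ) (a b : MIdx d k) :
    ∫ x, hvec d k x a * hvec d k x b ∂(stdG (Fin d)) = if a = b then 1 else 0 := by
  simp only [hvec_mul, stdG]
  rw [integral_fintype_prod_eq_prod (f := fun i x => He (a.1 i) x * He (b.1 i) x)]
  simp only [He_orth]
  split_ifs with h
  · subst h; simp
  · have : ∃ i, a.1 i ≠ b.1 i := by
      by_contra hc
      push Not at hc
      exact h (Subtype.ext (funext hc))
    obtain ⟨i, hi⟩ := this
    exact Finset.prod_eq_zero (Finset.mem_univ i) (by simp [hi])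

lemma hvec_integrable (d k : ℕ) (a b : MIdx d k) :
    Integrable (fun x => hvec d k x a * hvec d k x b) (stdG (Fin d)) := by
  simp only [hvec_mul, stdG]
  exact Integrable.fintype_prod_dep (f := fun i x => He (a.1 i) x * He (b.1 i) x)
    fun i => He_integrable _ _

lemma hvec_measurable (d k : ℕ) (a : MIdx d k) : Measurable fun x => hvec d k x a := by
  simp only [hvec]
  exact Finset.measurable_prod _ fun i _ => (He_measurable _).comp (measurable_pi_apply i)

lemma hvec_qf (d k : ℕ) (M : Matrix (MIdx d k) (MIdx d k) ℝ) (hM : M.PosSemidef) :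
    ∫⁻ x, ENNReal.ofReal (qf (hvec d k x) M) ∂(stdG (Fin d)) = ENNReal.ofReal M.trace := by
  have hi : ∀ a b, Integrable (fun x => hvec d k x a * hvec d k x b * M a b) (stdG (Fin d)) :=
    fun a b => (hvec_integrable d k a b).mul_const _
  rw [← ofReal_integral_eq_lintegral_ofReal]
  · congr 1
    simp only [qf_eq_sum]
    rw [integral_finsetSum _ fun a _ => integrable_finsetSum _ fun b _ => hi a b]
    simp only [Matrix.trace, Matrix.diag]
    refine Finset.sum_congr rfl fun a _ => ?_
    rw [integral_finsetSum _ fun b _ => hi a b]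
    simp only [integral_mul_const, hvec_orth]
    simp
  · simp only [qf_eq_sum]
    exact integrable_finsetSum _ fun a _ => integrable_finsetSum _ fun b _ => hi a b
  · exact Filter.Eventually.of_forall fun x => qf_nonneg hM _

/-- Hermite growth. -/
lemma He_growth (k : ℕ) : ∃ A : ℝ, 1 ≤ A ∧ ∀ j ≤ k, ∀ x : ℝ, He j x ^ 2 ≤ (A * (1 + x ^ 2)) ^ j := by
  have hpoly : ∀ j : ℕ, ∃ B : ℝ, 0 ≤ B ∧ ∀ x : ℝ, He j x ^ 2 ≤ B * (1 + x ^ 2) ^ j := by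
    intro j
    refine ⟨(∑ i ∈ Finset.range (j+1), |(HR j).coeff i|) ^ 2, sq_nonneg _, fun x => ?_⟩
    have hd : (HR j).natDegree ≤ j := by
      refine natDegree_map_le.trans ?_; simp
    have h1 : |(HR j).eval x| ≤ (∑ i ∈ Finset.range (j+1), |(HR j).coeff i|) * √(1 + x^2) ^ j := by
      rw [eval_eq_sum_range' (Nat.lt_succ_of_le hd), Finset.sum_mul]
      refine (Finset.abs_sum_le_sum_abs _ _).trans (Finset.sum_le_sum fun i hi => ?_)
      rw [abs_mul, abs_pow]
      refine mul_le_mul_of_nonneg_left ?_ (abs_nonneg _)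
      have a1 : |x| ≤ √(1 + x^2) := Real.abs_le_sqrt (by linarith)
      have a2 : 1 ≤ √(1 + x^2) := by
        rw [Real.one_le_sqrt]; nlinarith [sq_nonneg x]
      exact (pow_le_pow_left₀ (abs_nonneg _) a1 i).trans
        (pow_le_pow_right₀ a2 (Nat.lt_succ_iff.1 (Finset.mem_range.1 hi)))
    have h2 : He j x ^ 2 ≤ (HR j).eval x ^ 2 := by
      rw [He_eq, div_pow, Real.sq_sqrt (by positivity)]
      exact div_le_self (sq_nonneg _) (by exact_mod_cast Nat.factorial_pos j)
    refine h2.trans ?_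
    rw [← sq_abs]
    refine (pow_le_pow_left₀ (abs_nonneg _) h1 2).trans (le_of_eq ?_)
    rw [mul_pow, ← pow_mul, mul_comm j 2, pow_mul, Real.sq_sqrt (by positivity)]
  choose B hB0 hB using hpoly
  refine ⟨1 + ∑ j ∈ Finset.range (k+1), B j, ?_, ?_⟩
  · have : 0 ≤ ∑ j ∈ Finset.range (k+1), B j := Finset.sum_nonneg fun j _ => hB0 j
    linarith
  · intro j hj x
    have hs : B j ≤ ∑ j ∈ Finset.range (k+1), B j :=
      Finset.single_le_sum (fun j _ => hB0 j) (Finset.mem_range.2 (Nat.lt_succ_of_le hj))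
    rcases j with _ | j
    · simp [He]
    · refine (hB _ x).trans ?_
      rw [mul_pow]
      refine mul_le_mul_of_nonneg_right ?_ (by positivity)
      have h1 : 1 ≤ 1 + ∑ j ∈ Finset.range (k+1), B j := by linarith [hB0 (j+1)]
      calc B (j+1) ≤ 1 + ∑ j ∈ Finset.range (k+1), B j := by linarith
        _ ≤ _ := le_self_pow₀ h1 (by omega)

lemma sum_midx_le (d k : ℕ) (y : Fin d → ℝ) (hy : ∀ i, 0 ≤ y i) :
    ∑ κ : MIdx d k, ∏ i, y i ^ κ.1 i ≤ (∑ i, y i) ^ k := by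
  rw [Finset.sum_pow_eq_sum_piAntidiag]
  have e : Finset.piAntidiag Finset.univ k = Finset.Nat.antidiagonalTuple d k := by
    ext f; simp [Finset.Nat.mem_antidiagonalTuple, Finset.mem_piAntidiag]
  rw [e, ← Finset.sum_coe_sort (Finset.Nat.antidiagonalTuple d k)]
  refine Finset.sum_le_sum fun κ _ => ?_
  have h1 : (1 : ℝ) ≤ (Nat.multinomial Finset.univ κ.1 : ℝ) := by
    exact_mod_cast Nat.multinomial_pos _ _
  exact le_mul_of_one_le_left (Finset.prod_nonneg fun i _ => pow_nonneg (hy i) _) h1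

lemma card_midx_le (d k : ℕ) : (Fintype.card (MIdx d k) : ℝ) ≤ (d : ℝ) ^ k := by
  have := sum_midx_le d k (fun _ => 1) (fun _ => zero_le_one)
  simpa using this

lemma midx_le (d k : ℕ) (κ : MIdx d k) (i : Fin d) : κ.1 i ≤ k := by
  have := Finset.Nat.mem_antidiagonalTuple.1 κ.2
  refine le_trans ?_ this.le
  exact Finset.single_le_sum (f := κ.1) (fun _ _ => Nat.zero_le _) (Finset.mem_univ i)

lemma hvec_norm (k : ℕ) : ∃ A : ℝ, 1 ≤ A ∧ ∀ d : ℕ, ∀ x : Fin d → ℝ,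
    ∑ κ, hvec d k x κ ^ 2 ≤ (A * (d + ∑ i, x i ^ 2)) ^ k := by
  obtain ⟨A, hA, H⟩ := He_growth k
  refine ⟨A, hA, fun d x => ?_⟩
  calc ∑ κ, hvec d k x κ ^ 2 ≤ ∑ κ : MIdx d k, ∏ i, (A * (1 + x i ^ 2)) ^ κ.1 i := by
        refine Finset.sum_le_sum fun κ _ => ?_
        rw [hvec, ← Finset.prod_pow]
        exact Finset.prod_le_prod (fun i _ => sq_nonneg _) fun i _ => H _ (midx_le d k κ i) _
    _ ≤ (∑ i, (A * (1 + x i ^ 2))) ^ k := sum_midx_le d k _ fun i => by positivity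
    _ = _ := by rw [← Finset.mul_sum, Finset.sum_add_distrib]; simp

/-- chi-square tail -/
lemma chi_tail (d : ℕ) : stdG (Fin d) {x | 4 * (d : ℝ) < ∑ i, x i ^ 2} ≤
    ENNReal.ofReal (Real.exp (-(1/2 * d))) := by
  have hint : Integrable (fun x : ℝ => Real.exp (x ^ 2 / 4)) (gaussianReal 0 1) ∧
      ∫ x, Real.exp (x ^ 2 / 4) ∂(gaussianReal 0 1) = √2 := by
    have e : ∀ x : ℝ, gaussianPDFReal 0 1 x * Real.exp (x ^ 2 / 4) =
        (√(2 * Real.pi))⁻¹ * Real.exp (-(1/4) * x ^ 2) := by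
      intro x
      rw [gaussianPDFReal_def]
      simp only [NNReal.coe_one, mul_one, sub_zero]
      rw [mul_assoc, ← Real.exp_add]
      congr 2; ring
    constructor
    · rw [gaussianReal_of_var_ne_zero _ one_ne_zero,
        integrable_withDensity_iff_integrable_smul' (measurable_gaussianPDF _ _)
        (Filter.Eventually.of_forall fun x => gaussianPDF_lt_top)]
      simp only [toReal_gaussianPDF, smul_eq_mul, e]
      exact (integrable_exp_neg_mul_sq (by norm_num)).const_mul _
    · rw [integral_gaussianReal_eq_integral_smul one_ne_zero]
      simp only [smul_eq_mul, e]
      rw [integral_const_mul, integral_gaussian, ← Real.sqrt_inv, ← Real.sqrt_mul (by positivity)]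
      congr 1
      field_simp
      norm_num
  have hI : ∫⁻ x, ENNReal.ofReal (∏ i, Real.exp (x i ^ 2 / 4)) ∂(stdG (Fin d)) =
      ENNReal.ofReal (√2 ^ d) := by
    rw [← ofReal_integral_eq_lintegral_ofReal]
    · rw [stdG, integral_fintype_prod_eq_prod (f := fun _ x => Real.exp (x ^ 2 / 4))]
      simp [hint.2]
    · exact Integrable.fintype_prod_dep (f := fun _ x => Real.exp (x ^ 2 / 4)) fun i => hint.1
    · exact Filter.Eventually.of_forall fun x => Finset.prod_nonneg fun i _ => (Real.exp_pos _).le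
  have hs2 : √2 ≤ Real.exp (1/2) := by
    rw [Real.sqrt_le_left (Real.exp_pos _).le, ← Real.exp_nat_mul]
    have := Real.add_one_le_exp (1:ℝ)
    norm_num at this ⊢
    linarith
  have hm := mul_meas_ge_le_lintegral (μ := stdG (Fin d))
    (f := fun x => ENNReal.ofReal (∏ i, Real.exp (x i ^ 2 / 4))) (by
      apply Measurable.ennreal_ofReal
      exact Finset.measurable_prod _ fun i _ => by fun_prop) (ENNReal.ofReal (Real.exp d))
  rw [hI] at hm
  have hsub : stdG (Fin d) {x | 4 * (d : ℝ) < ∑ i, x i ^ 2} ≤ stdG (Fin d)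
      {x | ENNReal.ofReal (Real.exp d) ≤ ENNReal.ofReal (∏ i, Real.exp (x i ^ 2 / 4))} := by
    refine measure_mono fun x hx => ?_
    simp only [Set.mem_ofPred_eq] at hx ⊢
    apply ENNReal.ofReal_le_ofReal
    rw [← Real.exp_sum, ← Finset.sum_div]
    apply Real.exp_le_exp.2
    linarith
  refine hsub.trans ?_
  have h3 := mul_le_mul_right hm (ENNReal.ofReal (Real.exp (-d)))
  rw [← mul_assoc, ← ENNReal.ofReal_mul (Real.exp_pos _).le, ← Real.exp_add,
    ← ENNReal.ofReal_mul (Real.exp_pos _).le] at h3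
  simp only [neg_add_cancel, Real.exp_zero, ENNReal.ofReal_one, one_mul] at h3
  refine h3.trans (ENNReal.ofReal_le_ofReal ?_)
  calc Real.exp (-d) * √2 ^ d ≤ Real.exp (-d) * Real.exp (1/2) ^ d := by gcongr
    _ = _ := by rw [← Real.exp_nat_mul, ← Real.exp_add]; congr 1; ring

end HM

lemma opNorm_sq_le {ι κ : Type*} [Fintype ι] [Fintype κ] (A : ι → κ → ℝ) (T : ℝ) (hT : 0 ≤ T)
    (h : ∀ v : κ → ℝ, (∑ j, (v j) ^ 2) ≤ 1 → ∑ i, (∑ j, A i j * v j) ^ 2 ≤ T) :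
    opNorm A ^ 2 ≤ T := by
  have h0 : 0 ≤ opNorm A := Real.iSup_nonneg fun v => Real.sqrt_nonneg _
  have h1 : opNorm A ≤ √T := Real.iSup_le (fun v => Real.sqrt_le_sqrt (h v.1 v.2)) (Real.sqrt_nonneg _)
  calc opNorm A ^ 2 ≤ √T ^ 2 := pow_le_pow_left₀ h0 h1 2
    _ = T := Real.sq_sqrt hT

instance (d : ℕ) : IsProbabilityMeasure (stdG (Fin d)) := by
  unfold stdG; infer_instance

/-- truncated feature vector -/
def gvec (d k : ℕ) (x : Fin d → ℝ) : MIdx d k → ℝ :=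
  {x : Fin d → ℝ | ∑ i, x i ^ 2 ≤ 4 * (d : ℝ)}.indicator (hvec d k) x

lemma gvec_of_le (d k : ℕ) (x : Fin d → ℝ) (h : ∑ i, x i ^ 2 ≤ 4 * (d : ℝ)) :
    gvec d k x = hvec d k x := Set.indicator_of_mem (by simpa using h) _

lemma gvec_of_not (d k : ℕ) (x : Fin d → ℝ) (h : ¬ ∑ i, x i ^ 2 ≤ 4 * (d : ℝ)) :
    gvec d k x = 0 := Set.indicator_of_notMem (by simpa using h) _

lemma gvec_measurable (d k : ℕ) (a : MIdx d k) : Measurable fun x => gvec d k x a := by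
  have hs : MeasurableSet {x : Fin d → ℝ | ∑ i, x i ^ 2 ≤ 4 * (d : ℝ)} :=
    measurableSet_le (Finset.measurable_sum _ fun i _ => by fun_prop) measurable_const
  have : Measurable (gvec d k) :=
    (measurable_pi_iff.2 fun a => hvec_measurable d k a).indicator hs
  exact (measurable_pi_apply a).comp this

lemma gvec_qf (d k : ℕ) (M : Matrix (MIdx d k) (MIdx d k) ℝ) (hM : M.PosSemidef) :
    ∫⁻ x, ENNReal.ofReal (qf (gvec d k x) M) ∂(stdG (Fin d)) ≤ ENNReal.ofReal M.trace := by
  rw [← hvec_qf d k M hM]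
  refine lintegral_mono fun x => ENNReal.ofReal_le_ofReal ?_
  by_cases h : ∑ i, x i ^ 2 ≤ 4 * (d : ℝ)
  · rw [gvec_of_le d k x h]
  · rw [gvec_of_not d k x h]
    have := qf_nonneg hM (hvec d k x)
    simpa [qf] using this

lemma qf_Sg {Ω κ : Type*} [Fintype κ] [DecidableEq κ] (g : Ω → κ → ℝ) {n : ℕ} (ω : Fin n → Ω)
    (v : κ → ℝ) : qf v (Sg g ω) = ∑ i, (∑ j, g (ω i) j * v j) ^ 2 := by
  rw [qf_eq_sum]
  simp only [Sg, Matrix.sum_apply, Matrix.vecMulVec_apply, sq, Finset.mul_sum]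
  rw [Finset.sum_comm' (t' := Finset.univ) (s' := fun _ => Finset.univ) (by simp)]
  rw [Finset.sum_comm]
  have : ∀ y, ∑ x, ∑ i, v y * v x * (g (ω i) y * g (ω i) x) =
    ∑ i, ∑ x, v y * v x * (g (ω i) y * g (ω i) x) := fun y => Finset.sum_comm
  simp only [this]
  rw [Finset.sum_comm]
  refine Finset.sum_congr rfl fun i _ => Finset.sum_congr rfl fun a _ => ?_
  rw [Finset.sum_mul]
  exact Finset.sum_congr rfl fun b _ => by ring

theorem tail_bound (n d k : ℕ) (L : ℝ) (hL0 : 0 ≤ L) (hn : 1 ≤ n)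
    (hL : ∀ x : Fin d → ℝ, ∑ i, x i ^ 2 ≤ 4 * (d : ℝ) → ∑ κ, hvec d k x κ ^ 2 ≤ L) (p : ℕ) :
    1 - ENNReal.ofReal ((d : ℝ) ^ k * Real.exp (-((p : ℝ) + 1))) -
        ENNReal.ofReal (n * Real.exp (-(1/2 * d))) ≤
      (Measure.pi fun _ : Fin n => stdG (Fin d))
        {X | (opNorm fun (i : Fin n) (κ : MIdx d k) => hvec d k (X i) κ) ^ 2 ≤
          Real.exp 1 * (n + (p + 1) * L)} := by
  set P := Measure.pi fun _ : Fin n => stdG (Fin d) with hP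
  set T := Real.exp 1 * (n + (p + 1) * L) with hT
  have hn' : (1:ℝ) ≤ n := by exact_mod_cast hn
  have hQ0 : 0 < (n + (p + 1) * L : ℝ) := by positivity
  have hT0 : 0 < T := by positivity
  set G := {X : Fin n → Fin d → ℝ |
    (opNorm fun (i : Fin n) (κ : MIdx d k) => hvec d k (X i) κ) ^ 2 ≤ T} with hG
  set B1 := {X : Fin n → Fin d → ℝ |
    ENNReal.ofReal (T ^ (p+1)) ≤ ENNReal.ofReal ((Sg (gvec d k) X ^ (p+1)).trace)} with hB1
  set B2 := ⋃ i : Fin n, {X : Fin n → Fin d → ℝ | 4 * (d : ℝ) < ∑ j, X i j ^ 2} with hB2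
  have hcover : Set.univ ⊆ G ∪ (B1 ∪ B2) := by
    intro X _
    by_cases h2 : X ∈ B2
    · exact Or.inr (Or.inr h2)
    by_cases h1 : X ∈ B1
    · exact Or.inr (Or.inl h1)
    left
    have h2' : ∀ i, ∑ j, X i j ^ 2 ≤ 4 * (d : ℝ) := by
      intro i
      by_contra hc
      exact h2 (Set.mem_iUnion.2 ⟨i, by simpa using hc⟩)
    have h1' : (Sg (gvec d k) X ^ (p+1)).trace ≤ T ^ (p+1) := by
      by_contra hc
      exact h1 (ENNReal.ofReal_le_ofReal (not_le.1 hc).le)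
    change _ ≤ T
    refine opNorm_sq_le _ T hT0.le fun v hv => ?_
    have e := qf_Sg (gvec d k) X v
    simp only [fun i => gvec_of_le d k (X i) (h2' i)] at e
    rw [← e]
    have h3 := (qf_pow_le (Sg_psd (gvec d k) X) v hv p).trans h1'
    exact le_of_pow_le_pow_left₀ (Nat.succ_ne_zero p) hT0.le h3
  have hB2' : P B2 ≤ ENNReal.ofReal (n * Real.exp (-(1/2 * d))) := by
    refine (measure_iUnion_le _).trans ?_
    rw [tsum_fintype]
    have : ∀ i : Fin n, P {X : Fin n → Fin d → ℝ | 4 * (d : ℝ) < ∑ j, X i j ^ 2} ≤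
        ENNReal.ofReal (Real.exp (-(1/2 * d))) := by
      intro i
      have hmp := measurePreserving_eval (fun _ : Fin n => stdG (Fin d)) i
      have hs : MeasurableSet {x : Fin d → ℝ | 4 * (d : ℝ) < ∑ j, x j ^ 2} :=
        measurableSet_lt measurable_const (Finset.measurable_sum _ fun i _ => by fun_prop)
      have := hmp.measure_preimage hs.nullMeasurableSet
      refine le_trans (le_of_eq ?_) (chi_tail d)
      rw [← this]
      rfl
    refine (Finset.sum_le_sum fun i _ => this i).trans (le_of_eq ?_)
    rw [Finset.sum_const, Finset.card_univ, Fintype.card_fin, nsmul_eq_mul,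
      ENNReal.ofReal_mul (by positivity), ENNReal.ofReal_natCast]
  have hB1' : P B1 ≤ ENNReal.ofReal ((d : ℝ) ^ k * Real.exp (-((p : ℝ) + 1))) := by
    have hgL : ∀ x, ∑ j, gvec d k x j ^ 2 ≤ L := by
      intro x
      by_cases h : ∑ i, x i ^ 2 ≤ 4 * (d : ℝ)
      · rw [gvec_of_le d k x h]; exact hL x h
      · rw [gvec_of_not d k x h]; simpa using hL0
    have hm := moment_bound (stdG (Fin d)) (gvec d k) (gvec_measurable d k) L hL0 hgL
      (gvec_qf d k) (p+1) n
    have hmk := mul_meas_ge_le_lintegral (μ := P)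
      (measurable_trace_Sg (gvec d k) (gvec_measurable d k) (n := n) (p+1)).ennreal_ofReal
      (ENNReal.ofReal (T ^ (p+1)))
    have h3 := mul_le_mul_right (hmk.trans hm) (ENNReal.ofReal ((T ^ (p+1))⁻¹))
    rw [← mul_assoc, ← ENNReal.ofReal_mul (by positivity), inv_mul_cancel₀ (by positivity),
      ENNReal.ofReal_one, one_mul, ← ENNReal.ofReal_mul (by positivity)] at h3
    refine h3.trans (ENNReal.ofReal_le_ofReal ?_)
    have e : (T ^ (p+1))⁻¹ * (Fintype.card (MIdx d k) * ((n : ℝ) + (p+1 : ℕ) * L) ^ (p+1)) =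
        Fintype.card (MIdx d k) * Real.exp (-((p : ℝ) + 1)) := by
      have : Real.exp (-((p : ℝ) + 1)) = (Real.exp 1 ^ (p+1))⁻¹ := by
        rw [Real.exp_neg, ← Real.exp_nat_mul]; push_cast; simp
      rw [this, hT, mul_pow]
      push_cast
      field_simp
    rw [e]
    exact mul_le_mul_of_nonneg_right (card_midx_le d k) (Real.exp_pos _).le
  have h1 : 1 ≤ P G + (P B1 + P B2) := by
    calc (1 : ENNReal) = P Set.univ := by simp [hP]
      _ ≤ P (G ∪ (B1 ∪ B2)) := measure_mono hcover
      _ ≤ P G + P (B1 ∪ B2) := measure_union_le _ _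
      _ ≤ _ := by gcongr; exact measure_union_le _ _
  rw [tsub_le_iff_right, tsub_le_iff_right]
  calc 1 ≤ _ := h1
    _ ≤ P G + (ENNReal.ofReal ((d : ℝ) ^ k * Real.exp (-((p : ℝ) + 1))) +
        ENNReal.ofReal (n * Real.exp (-(1/2 * d)))) := by gcongr
    _ = _ := by ring

/-- **Lemma F.2**: operator-norm bound for the `n × B_{d,k}` matrix of degree-`k`
Hermite features of i.i.d. standard Gaussian samples. -/
theorem hermite_feature_matrix_opNorm (k : ℕ) (hk : 1 ≤ k) (D0 : ℝ) (hD0 : 0 < D0) :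
    ∃ C K c : ℝ, 0 < C ∧ 0 < K ∧ 0 < c ∧
      ∀ n d : ℕ, 1 ≤ n → 3 ≤ d →
        1 - ENNReal.ofReal (C * (d : ℝ) ^ (-D0)) -
            ENNReal.ofReal (C * n * Real.exp (-(c * d))) ≤
          (Measure.pi fun _ : Fin n => stdG (Fin d))
            {X | (opNorm fun (i : Fin n) (κ : MIdx d k) => hvec d k (X i) κ) ^ 2 ≤
              Real.log d ^ K * max (n : ℝ) ((d : ℝ) ^ k)} := by
  obtain ⟨A, hA, H⟩ := hvec_norm k
  have hlog3 : 1 < Real.log 3 := by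
    rw [Real.lt_log_iff_exp_lt (by norm_num)]
    have := Real.exp_one_lt_d9
    linarith
  set c1 : ℝ := Real.exp 1 * (1 + (k + D0 + 1) * (5 * A) ^ k) with hc1
  have hA0 : 0 < A := by linarith
  have hc1' : 1 ≤ c1 := by
    have h1 : (1:ℝ) ≤ Real.exp 1 := Real.one_le_exp zero_le_one
    have h2 : (1:ℝ) ≤ 1 + (k + D0 + 1) * (5 * A) ^ k := by
      have : 0 ≤ (k + D0 + 1) * (5 * A) ^ k := by positivity
      linarith
    exact one_le_mul_of_one_le_of_one_le h1 h2
  have hll : 0 < Real.log (Real.log 3) := Real.log_pos hlog3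
  set K1 := Real.log c1 / Real.log (Real.log 3) with hK1
  have hK10 : 0 ≤ K1 := div_nonneg (Real.log_nonneg hc1') hll.le
  refine ⟨1, 1 + K1, 1/2, one_pos, by linarith, by norm_num, ?_⟩
  intro n d hn hd
  have hd' : (3:ℝ) ≤ d := by exact_mod_cast hd
  have hd0 : (0:ℝ) < d := by linarith
  have hlogd3 : Real.log 3 ≤ Real.log d := Real.log_le_log (by norm_num) hd'
  have hlogd : 1 < Real.log d := lt_of_lt_of_le hlog3 hlogd3
  set p := ⌊(k + D0) * Real.log d⌋₊ with hp
  have hp1 : (k + D0) * Real.log d ≤ p + 1 := (Nat.lt_floor_add_one _).le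
  have hp2 : (p : ℝ) + 1 ≤ (k + D0 + 1) * Real.log d := by
    have : (p : ℝ) ≤ (k + D0) * Real.log d := Nat.floor_le (by positivity)
    linarith
  have hL0 : 0 ≤ (A * (5 * d)) ^ k := by positivity
  have hb := tail_bound n d k ((A * (5 * d)) ^ k) hL0 hn (fun x hx => (H d x).trans (by
    have : 0 ≤ ∑ i, x i ^ 2 := Finset.sum_nonneg fun _ _ => sq_nonneg _
    apply pow_le_pow_left₀ (by positivity)
    apply mul_le_mul_of_nonneg_left _ hA0.le
    linarith)) p
  refine le_trans ?_ (hb.trans (measure_mono ?_))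
  · rw [one_mul, one_mul]
    refine tsub_le_tsub_right (tsub_le_tsub_left (ENNReal.ofReal_le_ofReal ?_) _) _
    rw [Real.rpow_def_of_pos hd0, ← Real.exp_log (pow_pos hd0 k), ← Real.exp_add, Real.log_pow]
    apply Real.exp_le_exp.2
    linarith
  · intro X hX
    simp only [Set.mem_ofPred_eq] at hX ⊢
    refine hX.trans ?_
    set m := max (n : ℝ) ((d : ℝ) ^ k) with hm
    have hm1 : (n : ℝ) ≤ m := le_max_left _ _
    have hm2 : (d : ℝ) ^ k ≤ m := le_max_right _ _
    have hm0 : 0 ≤ m := le_trans (Nat.cast_nonneg _) hm1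
    have s1 : (n : ℝ) + (p + 1) * (A * (5 * d)) ^ k ≤
        (1 + (k + D0 + 1) * (5 * A) ^ k) * Real.log d * m := by
      have a1 : (n : ℝ) ≤ Real.log d * m := by nlinarith
      have a2 : ((p : ℝ) + 1) * (A * (5 * d)) ^ k ≤
          ((k + D0 + 1) * Real.log d) * ((5 * A) ^ k * m) := by
        have e : (A * (5 * d)) ^ k = (5 * A) ^ k * (d:ℝ) ^ k := by rw [← mul_pow]; ring
        rw [e]
        gcongr
      calc _ ≤ Real.log d * m + ((k + D0 + 1) * Real.log d) * ((5 * A) ^ k * m) := add_le_add a1 a2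
        _ = _ := by ring
    have s2 : c1 ≤ Real.log d ^ K1 := by
      calc c1 = Real.log 3 ^ K1 := by
            rw [Real.rpow_def_of_pos (by linarith), hK1, mul_div_cancel₀ _ hll.ne', Real.exp_log]
            linarith
        _ ≤ _ := Real.rpow_le_rpow (by linarith) hlogd3 hK10
    rw [Real.rpow_add (by linarith), Real.rpow_one]
    calc _ ≤ Real.exp 1 * ((1 + (k + D0 + 1) * (5 * A) ^ k) * Real.log d * m) :=
          mul_le_mul_of_nonneg_left s1 (Real.exp_pos _).le
      _ = Real.log d * c1 * m := by rw [hc1]; ring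
      _ ≤ _ := by gcongr
end
end

section
/- Spike-plus-bounded decomposition for the degree-2 feature matrix (Lemma F.3 and Corollary F.4). Let w₁,…,w_p be i.i.d. uniform on the unit sphere S^{d−1} of ℝ^d and let V₂ := [q₂(w₁),…,q₂(w_p)]ᵀ ∈ ℝ^{p×B_{d,2}}. Let e_c ∈ ℝ^{B_{d,2}} be the 0/1 vector supported exactly on the d multi-indices 𝐤 = 2e_j (i.e., on the coordinates of q₂(w) equal to w_j²). Then E[V₂] = (1/d)·1_p·e_cᵀ, and writing V₂ = (1/d)1_p e_cᵀ + V_{2c} with V_{2c} mean-zero, for any constant D₀ > 0 there exist constants C, K > 0 depending only on D₀ such that for all d ≥ 3 and p ≥ 1, with probability at least 1 − C·d^{−D₀}: ‖V_{2c}‖_op² ≤ (log d)^K · max(1, p/d²). -/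
noncomputable section

open MeasureTheory ProbabilityTheory

/-- Euclidean norm on `ι → ℝ`. -/
def enorm2 {ι : Type*} [Fintype ι] (u : ι → ℝ) : ℝ := Real.sqrt (∑ i, (u i) ^ 2)

/-- The uniform distribution on the unit sphere of `ι → ℝ`. -/
def unifSphere (ι : Type*) [Fintype ι] : Measure (ι → ℝ) :=
  (stdG ι).map fun x => (enorm2 x)⁻¹ • x

/-- The vector `q_k(w)`, with entry `(k!/(k₁!⋯k_d!))^{1/2} ∏ w_j^{k_j}` at the
multi-index `(k₁,…,k_d)`. -/
def qvec (d k : ℕ) (w : Fin d → ℝ) : MIdx d k → ℝ :=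
  fun κ => Real.sqrt ((Nat.factorial k : ℝ) / ∏ i, (Nat.factorial (κ.1 i) : ℝ)) *
    ∏ i, (w i) ^ (κ.1 i)

/-- The 0/1 vector `e_c ∈ ℝ^{B_{d,2}}` supported exactly on the `d` multi-indices
`2·e_j` (the coordinates of `q₂(w)` equal to `w_j²`). -/
def eC (d : ℕ) (κ : MIdx d 2) : ℝ := if ∃ j, κ.1 j = 2 then 1 else 0

lemma aux_spectral {ι : Type*} [Fintype ι] [DecidableEq ι] (A : Matrix ι ι ℝ) (hA : A.PosSemidef) :
    ∃ (U : Matrix ι ι ℝ) (l : ι → ℝ), (∀ i, 0 ≤ l i) ∧ U * U.transpose = 1 ∧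
      U.transpose * U = 1 ∧ A = U * Matrix.diagonal l * U.transpose := by
  refine ⟨hA.1.eigenvectorUnitary, hA.1.eigenvalues, hA.eigenvalues_nonneg, ?_, ?_, ?_⟩
  · have := Unitary.coe_mul_star_self hA.1.eigenvectorUnitary
    rwa [Unitary.coe_star, Matrix.star_eq_conjTranspose, Matrix.conjTranspose_eq_transpose_of_trivial] at this
  · have := Unitary.coe_star_mul_self hA.1.eigenvectorUnitary
    rwa [Matrix.star_eq_conjTranspose, Matrix.conjTranspose_eq_transpose_of_trivial] at this
  · have := hA.1.spectral_theorem
    rw [Unitary.conjStarAlgAut_apply] at this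
    simpa [Matrix.star_eq_conjTranspose, Function.comp_def] using this

lemma aux_pow {ι : Type*} [Fintype ι] [DecidableEq ι] (U : Matrix ι ι ℝ) (l : ι → ℝ)
    (h1 : U * U.transpose = 1) (h2 : U.transpose * U = 1) (n : ℕ) :
    (U * Matrix.diagonal l * U.transpose) ^ n =
      U * Matrix.diagonal (fun i => l i ^ n) * U.transpose := by
  induction n with
  | zero => simp [h1]
  | succ n ih =>
    rw [pow_succ, ih]
    calc _ = U * Matrix.diagonal (fun i => l i ^ n) * (U.transpose * U) * Matrix.diagonal l * U.transpose := by
          simp only [Matrix.mul_assoc]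
      _ = _ := by
          rw [h2, Matrix.mul_one, Matrix.mul_assoc U, Matrix.diagonal_mul_diagonal]
          simp only [pow_succ]

lemma aux_quad {ι : Type*} [Fintype ι] [DecidableEq ι] (U : Matrix ι ι ℝ) (f : ι → ℝ) (x : ι → ℝ) :
    x ⬝ᵥ ((U * Matrix.diagonal f * U.transpose).mulVec x) =
      ∑ i, (U.transpose.mulVec x i) ^ 2 * f i := by
  rw [← Matrix.mulVec_mulVec, ← Matrix.mulVec_mulVec, Matrix.dotProduct_mulVec,
    ← Matrix.mulVec_transpose]
  simp only [dotProduct, Matrix.mulVec_diagonal]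
  exact Finset.sum_congr rfl fun i _ => by ring

lemma aux_telescope {R : Type*} [Ring R] (A E : R) (n : ℕ) :
    (A + E) ^ n = A ^ n + ∑ k ∈ Finset.range n, A ^ k * E * (A + E) ^ (n - 1 - k) := by
  induction n with
  | zero => simp
  | succ n ih =>
    rw [Finset.sum_range_succ']
    have : (A + E) ^ (n+1) = A * (A+E)^n + E * (A+E)^n := by rw [pow_succ', add_mul]
    rw [this]
    nth_rewrite 1 [ih]
    rw [mul_add, Finset.mul_sum, pow_succ', add_assoc]
    congr 2
    · refine Finset.sum_congr rfl fun k hk => ?_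
      rw [pow_succ']
      have : n + 1 - 1 - (k+1) = n - 1 - k := by omega
      rw [this]; simp only [mul_assoc]
    · simp

lemma aux_cheb {ι : Type*} [Fintype ι] (w f g : ι → ℝ) (hw : ∀ i, 0 ≤ w i) (hw1 : ∑ i, w i ≤ 1)
    (hf : ∀ i, 0 ≤ f i) (hg : ∀ i, 0 ≤ g i)
    (h : ∀ i j, 0 ≤ (f i - f j) * (g i - g j)) :
    (∑ i, w i * f i) * (∑ i, w i * g i) ≤ ∑ i, w i * (f i * g i) := by
  have h0 : 0 ≤ ∑ i, ∑ j, w i * w j * ((f i - f j) * (g i - g j)) :=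
    Finset.sum_nonneg fun i _ => Finset.sum_nonneg fun j _ =>
      mul_nonneg (mul_nonneg (hw i) (hw j)) (h i j)
  have h1 : ∑ i, ∑ j, w i * w j * ((f i - f j) * (g i - g j)) =
      2 * ((∑ i, w i) * ∑ i, w i * (f i * g i)) - 2 * ((∑ i, w i * f i) * (∑ i, w i * g i)) := by
    have e : ∀ i j, w i * w j * ((f i - f j) * (g i - g j)) =
      (w j) * (w i * (f i * g i)) + w i * (w j * (f j * g j)) - (w i * f i) * (w j * g j) - (w j * f j) * (w i * g i) := by
      intros; ring
    simp only [e, Finset.sum_sub_distrib, Finset.sum_add_distrib, ← Finset.mul_sum, ← Finset.sum_mul]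
    ring
  have h2 : (∑ i, w i) * ∑ i, w i * (f i * g i) ≤ 1 * ∑ i, w i * (f i * g i) :=
    mul_le_mul_of_nonneg_right hw1 (Finset.sum_nonneg fun i _ =>
      mul_nonneg (hw i) (mul_nonneg (hf i) (hg i)))
  linarith

lemma aux_cheb_mat {ι : Type*} [Fintype ι] [DecidableEq ι] (A : Matrix ι ι ℝ) (hA : A.PosSemidef)
    (x : ι → ℝ) (hx : ∑ i, x i ^ 2 ≤ 1) (k l : ℕ) :
    (x ⬝ᵥ ((A ^ k).mulVec x)) * (x ⬝ᵥ (((A + 1) ^ l).mulVec x)) ≤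
      x ⬝ᵥ ((A ^ k * (A + 1) ^ l).mulVec x) := by
  obtain ⟨U, e, he, h1, h2, rfl⟩ := aux_spectral A hA
  have h3 : U * Matrix.diagonal e * U.transpose + 1 =
      U * Matrix.diagonal (fun i => e i + 1) * U.transpose := by
    have : Matrix.diagonal (fun i => e i + 1) = Matrix.diagonal e + 1 := by
      ext i j; by_cases h : i = j <;> simp [Matrix.diagonal, h]
    rw [this, Matrix.mul_add, Matrix.add_mul, Matrix.mul_one, h1]
  have h4 : ∀ f g : ι → ℝ, (U * Matrix.diagonal f * U.transpose) * (U * Matrix.diagonal g * U.transpose)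
      = U * Matrix.diagonal (fun i => f i * g i) * U.transpose := by
    intro f g
    calc _ = U * Matrix.diagonal f * (U.transpose * U) * Matrix.diagonal g * U.transpose := by
          simp only [Matrix.mul_assoc]
      _ = _ := by
          rw [h2, Matrix.mul_one, Matrix.mul_assoc U, Matrix.diagonal_mul_diagonal]
  rw [h3, aux_pow U _ h1 h2, aux_pow U _ h1 h2, h4, aux_quad, aux_quad, aux_quad]
  apply aux_cheb
  · intro i; positivity
  · have := aux_quad U (fun _ => 1) x
    simp only [Matrix.diagonal_one, Matrix.mul_one, h1, Matrix.one_mulVec, mul_one] at this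
    rw [← this]
    simpa [dotProduct, sq] using hx
  · intro i; have := he i; positivity
  · intro i; have := he i; positivity
  · intro i j
    have hi := he i
    have hj := he j
    rcases le_total (e i) (e j) with h | h
    · apply mul_nonneg_of_nonpos_of_nonpos
      · linarith [pow_le_pow_left₀ hi h k]
      · linarith [pow_le_pow_left₀ (by linarith : 0 ≤ e i + 1) (by linarith : e i + 1 ≤ e j + 1) l]
    · apply mul_nonneg
      · linarith [pow_le_pow_left₀ hj h k]
      · linarith [pow_le_pow_left₀ (by linarith : 0 ≤ e j + 1) (by linarith : e j + 1 ≤ e i + 1) l]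

lemma aux_rank_one {ι : Type*} [Fintype ι] [DecidableEq ι] (A : Matrix ι ι ℝ) (hA : A.PosSemidef)
    (x : ι → ℝ) (hx : ∑ i, x i ^ 2 ≤ 1) (n : ℕ) :
    x ⬝ᵥ (((A + Matrix.vecMulVec x x) ^ n).mulVec x) ≤ x ⬝ᵥ (((A + 1) ^ n).mulVec x) := by
  induction n using Nat.strong_induction_on with
  | _ n ih =>
    rw [aux_telescope A (Matrix.vecMulVec x x), aux_telescope A 1]
    simp only [Matrix.add_mulVec, dotProduct_add, Matrix.sum_mulVec, dotProduct_sum]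
    gcongr with k hk
    have hk' := Finset.mem_range.1 hk
    have e1 : x ⬝ᵥ (A ^ k * Matrix.vecMulVec x x * (A + Matrix.vecMulVec x x) ^ (n - 1 - k)).mulVec x
        = (x ⬝ᵥ ((A ^ k).mulVec x)) * (x ⬝ᵥ (((A + Matrix.vecMulVec x x) ^ (n-1-k)).mulVec x)) := by
      rw [← Matrix.mulVec_mulVec, ← Matrix.mulVec_mulVec, Matrix.vecMulVec_mulVec]
      simp [Matrix.mulVec_smul, mul_comm]
    rw [e1, mul_one]
    refine le_trans ?_ (aux_cheb_mat A hA x hx k (n-1-k))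
    refine mul_le_mul_of_nonneg_left (ih _ (by omega)) ?_
    have := (hA.pow k).dotProduct_mulVec_nonneg x
    simpa using this

lemma aux_trace_bound {ι : Type*} [Fintype ι] [DecidableEq ι] (A : Matrix ι ι ℝ) (hA : A.PosSemidef)
    (m : ℕ) (hm : m ≠ 0) (t : ℝ) (ht : 0 ≤ t) (h : (A ^ m).trace ≤ t ^ m)
    (x : ι → ℝ) (hx : ∑ i, x i ^ 2 ≤ 1) : x ⬝ᵥ (A.mulVec x) ≤ t := by
  obtain ⟨U, e, he, h1, h2, rfl⟩ := aux_spectral A hA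
  rw [aux_pow U _ h1 h2, Matrix.trace_mul_comm, ← Matrix.mul_assoc, h2, Matrix.one_mul, Matrix.trace_diagonal] at h
  have h5 : ∀ i, e i ≤ t := by
    intro i
    have : e i ^ m ≤ t ^ m := le_trans (Finset.single_le_sum (f := fun i => e i ^ m) (fun j _ => pow_nonneg (he j) m) (Finset.mem_univ i)) h
    exact le_of_pow_le_pow_left₀ hm ht this
  rw [aux_quad]
  have := aux_quad U (fun _ => 1) x
  simp only [Matrix.diagonal_one, Matrix.mul_one, h1, Matrix.one_mulVec, mul_one] at this
  have h6 : ∑ i, (U.transpose.mulVec x i) ^ 2 ≤ 1 := by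
    rw [← this]
    simpa [dotProduct, sq] using hx
  calc _ ≤ ∑ i, (U.transpose.mulVec x i) ^ 2 * t := by gcongr with i; exact h5 i
    _ = (∑ i, (U.transpose.mulVec x i) ^ 2) * t := by rw [Finset.sum_mul]
    _ ≤ 1 * t := by gcongr
    _ = t := one_mul t

/-- bounded measurable real functions -/
def AuxBM {Ω : Type*} [MeasurableSpace Ω] (f : Ω → ℝ) : Prop := Measurable f ∧ ∃ C, ∀ ω, |f ω| ≤ C

namespace AuxBM
variable {Ω : Type*} [MeasurableSpace Ω]

lemma const (c : ℝ) : AuxBM (fun _ : Ω => c) := ⟨measurable_const, |c|, fun _ => le_rfl⟩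

lemma add {f g : Ω → ℝ} (hf : AuxBM f) (hg : AuxBM g) : AuxBM (fun ω => f ω + g ω) := by
  obtain ⟨a, A, hA⟩ := hf
  obtain ⟨b, B, hB⟩ := hg
  exact ⟨a.add b, A + B, fun ω => (abs_add_le _ _).trans (add_le_add (hA ω) (hB ω))⟩

lemma mul {f g : Ω → ℝ} (hf : AuxBM f) (hg : AuxBM g) : AuxBM (fun ω => f ω * g ω) := by
  obtain ⟨a, A, hA⟩ := hf
  obtain ⟨b, B, hB⟩ := hg
  refine ⟨a.mul b, A * B, fun ω => ?_⟩
  rw [abs_mul]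
  exact mul_le_mul (hA ω) (hB ω) (abs_nonneg _) ((abs_nonneg _).trans (hA ω))

lemma sum {α : Type*} (s : Finset α) {f : α → Ω → ℝ} (hf : ∀ a ∈ s, AuxBM (f a)) :
    AuxBM (fun ω => ∑ a ∈ s, f a ω) := by
  classical
  induction s using Finset.induction_on with
  | empty => simpa using const 0
  | insert a s ha ih =>
    simp only [Finset.sum_insert ha]
    exact (hf a (by simp)).add (ih fun b hb => hf b (by simp [hb]))

lemma integrable {f : Ω → ℝ} (hf : AuxBM f) (μ : Measure Ω) [IsFiniteMeasure μ] : Integrable f μ := by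
  obtain ⟨a, A, hA⟩ := hf
  exact Integrable.of_bound a.aestronglyMeasurable A (Filter.Eventually.of_forall hA)

lemma comp {Ω' : Type*} [MeasurableSpace Ω'] {f : Ω → ℝ} (hf : AuxBM f) {g : Ω' → Ω}
    (hg : Measurable g) : AuxBM (fun ω => f (g ω)) := by
  obtain ⟨a, A, hA⟩ := hf
  exact ⟨a.comp hg, A, fun ω => hA _⟩

end AuxBM

lemma auxBM_pow {Ω : Type*} [MeasurableSpace Ω] {ι : Type*} [Fintype ι] [DecidableEq ι]
    (M : Ω → Matrix ι ι ℝ) (hM : ∀ i j, AuxBM (fun ω => M ω i j)) (n : ℕ) :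
    ∀ i j, AuxBM (fun ω => (M ω ^ n) i j) := by
  induction n with
  | zero => intro i j; simpa using AuxBM.const _
  | succ n ih =>
    intro i j
    simp only [pow_succ, Matrix.mul_apply]
    exact AuxBM.sum _ fun k _ => (ih i k).mul (hM k j)

/-- sum of rank one matrices -/
def auxS {Ω : Type*} {ι : Type*} {α : Type*} (X : Ω → ι → ℝ)
    (T : Finset α) (ω : α → Ω) : Matrix ι ι ℝ :=
  ∑ i ∈ T, Matrix.vecMulVec (X (ω i)) (X (ω i))

lemma auxS_psd {Ω : Type*} {ι : Type*} [Fintype ι] {α : Type*} (X : Ω → ι → ℝ)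
    (T : Finset α) (ω : α → Ω) : (auxS X T ω).PosSemidef := by
  unfold auxS
  refine Matrix.posSemidef_sum T fun i _ => ?_
  simpa using Matrix.posSemidef_vecMulVec_self_star (X (ω i))

lemma auxS_bm {Ω : Type*} [MeasurableSpace Ω] {ι : Type*} [Fintype ι] [DecidableEq ι] {α : Type*}
    (X : Ω → ι → ℝ) (hX : ∀ k, AuxBM (fun w => X w k)) (T : Finset α) (c : ℝ) :
    ∀ k l, AuxBM (fun ω : α → Ω => (c • (1 : Matrix ι ι ℝ) + auxS X T ω) k l) := by
  intro k l
  simp only [Matrix.add_apply, auxS, Matrix.sum_apply, Matrix.vecMulVec_apply]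
  refine (AuxBM.const _).add (AuxBM.sum _ fun i _ => ?_)
  exact ((hX k).comp (measurable_pi_apply i)).mul ((hX l).comp (measurable_pi_apply i))

lemma aux_indep {Ω : Type*} [MeasurableSpace Ω] (μ : Measure Ω) [IsProbabilityMeasure μ] {p : ℕ}
    (T : Finset (Fin p)) (i : Fin p) (hi : i ∉ T) (f : Ω → ℝ) (hf : AuxBM f)
    (g : (T → Ω) → ℝ) (hg : AuxBM g) :
    ∫ ω, f (ω i) * g (fun j => ω j) ∂(Measure.pi fun _ : Fin p => μ) =
      (∫ w, f w ∂μ) * ∫ ω, g (fun j => ω j) ∂(Measure.pi fun _ : Fin p => μ) := by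
  have h0 : iIndepFun (fun (i : Fin p) (ω : Fin p → Ω) => ω i) (Measure.pi fun _ : Fin p => μ) :=
    iIndepFun_pi (X := fun _ w => w) (fun _ => aemeasurable_id)
  have h1 := h0.indepFun_finset {i} T (by simpa using hi) (fun j => measurable_pi_apply j)
  have hm1 : Measurable (fun y : ({i} : Finset (Fin p)) → Ω => f (y ⟨i, by simp⟩)) :=
    hf.1.comp (measurable_pi_apply _)
  have h2 := h1.integral_fun_comp_mul_comp (f := fun y => f (y ⟨i, by simp⟩)) (g := g)
    (measurable_pi_lambda _ fun j => measurable_pi_apply _).aemeasurable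
    (measurable_pi_lambda _ fun j => measurable_pi_apply _).aemeasurable
    hm1.aestronglyMeasurable hg.1.aestronglyMeasurable
  rw [h2]
  congr 1
  have h3 := integral_map (μ := Measure.pi fun _ : Fin p => μ) (φ := fun ω => ω i) (f := f)
    (measurable_pi_apply i).aemeasurable hf.1.aestronglyMeasurable
  rw [(measurePreserving_eval (fun _ : Fin p => μ) i).map_eq] at h3
  exact h3.symm

theorem aux_moment {Ω : Type*} [MeasurableSpace Ω] (μ : Measure Ω) [IsProbabilityMeasure μ]
    {ι : Type*} [Fintype ι] [DecidableEq ι] (X : Ω → ι → ℝ) (hX : ∀ k, AuxBM (fun w => X w k))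
    (hX1 : ∀ w, ∑ k, X w k ^ 2 ≤ 1) (σ : ℝ) (hσ : 0 ≤ σ)
    (hcov : ∀ M : Matrix ι ι ℝ, M.PosSemidef →
      ∑ k, ∑ l, (∫ w, X w k * X w l ∂μ) * M k l ≤ σ * M.trace)
    (p m : ℕ) : ∀ (c : ℝ), 0 ≤ c → ∀ (T : Finset (Fin p)),
    ∫ ω, ((c • (1 : Matrix ι ι ℝ) + auxS X T ω) ^ m).trace ∂(Measure.pi fun _ : Fin p => μ) ≤
      Fintype.card ι * (c + m + T.card * σ) ^ m := by
  induction m with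
  | zero => intro c hc T; simp
  | succ m ih =>
    intro c hc T
    set P := Measure.pi fun _ : Fin p => μ
    have hpow : ∀ (c : ℝ) (T : Finset (Fin p)) n k l,
        AuxBM (fun ω : Fin p → Ω => ((c • (1 : Matrix ι ι ℝ) + auxS X T ω) ^ n) k l) :=
      fun c T n => auxBM_pow _ (auxS_bm X hX T c) n
    have htr : ∀ (c : ℝ) (T : Finset (Fin p)) n,
        AuxBM (fun ω : Fin p → Ω => ((c • (1 : Matrix ι ι ℝ) + auxS X T ω) ^ n).trace) :=
      fun c T n => AuxBM.sum _ fun k _ => hpow c T n k k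
    have hXi : ∀ (i : Fin p) k, AuxBM (fun ω : Fin p → Ω => X (ω i) k) :=
      fun i k => (hX k).comp (measurable_pi_apply i)
    have hpsd : ∀ (c : ℝ) (hc : 0 ≤ c) (T : Finset (Fin p)) ω,
        (c • (1 : Matrix ι ι ℝ) + auxS X T ω).PosSemidef :=
      fun c hc T ω => (Matrix.PosSemidef.one.smul hc).add (auxS_psd X T ω)
    -- quadratic form term
    let Q : Fin p → (Fin p → Ω) → ℝ := fun i ω =>
      X (ω i) ⬝ᵥ ((((c + 1) • (1 : Matrix ι ι ℝ) + auxS X (T.erase i) ω) ^ m).mulVec (X (ω i)))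
    have hQe : ∀ i ω, Q i ω = ∑ k, ∑ l, (X (ω i) k * X (ω i) l) *
        (((c + 1) • (1 : Matrix ι ι ℝ) + auxS X (T.erase i) ω) ^ m) k l := by
      intro i ω
      simp only [Q, dotProduct, Matrix.mulVec, Finset.mul_sum]
      exact Finset.sum_congr rfl fun k _ => Finset.sum_congr rfl fun l _ => by ring
    have hQ1 : ∀ i k l, AuxBM (fun ω : Fin p → Ω => (X (ω i) k * X (ω i) l) *
        (((c + 1) • (1 : Matrix ι ι ℝ) + auxS X (T.erase i) ω) ^ m) k l) :=
      fun i k l => ((hXi i k).mul (hXi i l)).mul (hpow _ _ _ _ _)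
    have hQ : ∀ i, AuxBM (Q i) := by
      intro i
      have : Q i = fun ω => _ := funext (hQe i)
      rw [this]
      exact AuxBM.sum _ fun k _ => AuxBM.sum _ fun l _ => hQ1 i k l
    have hpt : ∀ ω, ((c • (1 : Matrix ι ι ℝ) + auxS X T ω) ^ (m+1)).trace ≤
        c * ((c • (1 : Matrix ι ι ℝ) + auxS X T ω) ^ m).trace + ∑ i ∈ T, Q i ω := by
      intro ω
      rw [pow_succ']
      nth_rewrite 1 [auxS]
      rw [Matrix.add_mul, Matrix.trace_add, Matrix.smul_mul, Matrix.one_mul, Matrix.trace_smul,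
        smul_eq_mul, Finset.sum_mul, Matrix.trace_sum]
      gcongr with i hi
      have e1 : c • (1 : Matrix ι ι ℝ) + auxS X T ω =
          (c • (1 : Matrix ι ι ℝ) + auxS X (T.erase i) ω) + Matrix.vecMulVec (X (ω i)) (X (ω i)) := by
        unfold auxS
        rw [add_assoc, Finset.sum_erase_add _ _ hi]
      have e2 : (c + 1) • (1 : Matrix ι ι ℝ) + auxS X (T.erase i) ω =
          (c • (1 : Matrix ι ι ℝ) + auxS X (T.erase i) ω) + 1 := by
        rw [add_smul, one_smul]; abel
      have := aux_rank_one _ (hpsd c hc (T.erase i) ω) (X (ω i)) (hX1 _) m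
      rw [← e1, ← e2] at this
      refine le_trans (le_of_eq ?_) this
      rw [Matrix.trace_mul_comm, Matrix.mul_vecMulVec, Matrix.trace_vecMulVec, dotProduct_comm]
    have hQint : ∀ i ∈ T, ∫ ω, Q i ω ∂P ≤ σ * (Fintype.card ι * (c + 1 + m + (T.erase i).card * σ) ^ m) := by
      intro i hi
      have h1 : ∫ ω, Q i ω ∂P = ∫ ω, ∑ k, ∑ l, (∫ w, X w k * X w l ∂μ) *
          (((c + 1) • (1 : Matrix ι ι ℝ) + auxS X (T.erase i) ω) ^ m) k l ∂P := by
        simp only [hQe]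
        rw [integral_finsetSum _ fun k _ => (AuxBM.sum _ fun l _ => hQ1 i k l).integrable P,
          integral_finsetSum _ fun k _ => (AuxBM.sum _ fun l _ => (AuxBM.const _).mul (hpow _ _ _ _ _)).integrable P]
        refine Finset.sum_congr rfl fun k _ => ?_
        rw [integral_finsetSum _ fun l _ => (hQ1 i k l).integrable P,
          integral_finsetSum _ fun l _ => ((AuxBM.const _).mul (hpow _ _ _ _ _)).integrable P]
        refine Finset.sum_congr rfl fun l _ => ?_
        rw [integral_const_mul]
        have h2 := aux_indep μ (T.erase i) i (by simp) (fun w => X w k * X w l) ((hX k).mul (hX l))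
          (fun y : (T.erase i) → Ω => (((c + 1) • (1 : Matrix ι ι ℝ) + auxS X Finset.univ y) ^ m) k l)
          (auxBM_pow _ (auxS_bm X hX Finset.univ (c+1)) m k l)
        have h3 : ∀ ω : Fin p → Ω, auxS X Finset.univ (fun j : (T.erase i) => ω j) = auxS X (T.erase i) ω := by
          intro ω
          unfold auxS
          exact Finset.sum_coe_sort (T.erase i) (fun j => Matrix.vecMulVec (X (ω j)) (X (ω j)))
        simp only [h3] at h2
        exact h2
      rw [h1]
      refine le_trans (integral_mono (g := fun ω => σ * (((c + 1) • (1 : Matrix ι ι ℝ) + auxS X (T.erase i) ω) ^ m).trace) ?_ ?_ ?_) ?_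
      · exact (AuxBM.sum _ fun k _ => AuxBM.sum _ fun l _ => (AuxBM.const _).mul (hpow _ _ _ _ _)).integrable P
      · exact ((AuxBM.const _).mul (htr _ _ _)).integrable P
      · intro ω
        exact hcov _ ((hpsd (c+1) (by linarith) _ ω).pow m)
      · rw [integral_const_mul]
        exact mul_le_mul_of_nonneg_left (ih (c+1) (by linarith) _) hσ
    calc _ ≤ ∫ ω, c * ((c • (1 : Matrix ι ι ℝ) + auxS X T ω) ^ m).trace + ∑ i ∈ T, Q i ω ∂P :=
          integral_mono ((htr _ _ _).integrable P)
            ((((AuxBM.const _).mul (htr _ _ _)).add (AuxBM.sum _ fun i _ => hQ i)).integrable P) hpt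
      _ = c * ∫ ω, ((c • (1 : Matrix ι ι ℝ) + auxS X T ω) ^ m).trace ∂P + ∑ i ∈ T, ∫ ω, Q i ω ∂P := by
          rw [integral_add (((AuxBM.const _).mul (htr _ _ _)).integrable P)
            ((AuxBM.sum _ fun i _ => hQ i).integrable P), integral_const_mul,
            integral_finsetSum _ fun i _ => (hQ i).integrable P]
      _ ≤ c * (Fintype.card ι * (c + m + T.card * σ) ^ m) +
            ∑ i ∈ T, σ * (Fintype.card ι * (c + 1 + m + (T.erase i).card * σ) ^ m) :=
          add_le_add (mul_le_mul_of_nonneg_left (ih c hc T) hc) (Finset.sum_le_sum hQint)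
      _ ≤ c * (Fintype.card ι * (c + (m + 1 : ℕ) + T.card * σ) ^ m) +
            ∑ i ∈ T, σ * (Fintype.card ι * (c + (m + 1 : ℕ) + T.card * σ) ^ m) := by
          have hT : ∀ i, ((T.erase i).card : ℝ) ≤ T.card := fun i => by
            exact_mod_cast Finset.card_le_card (Finset.erase_subset i T)
          gcongr ?_ + ?_
          · gcongr
            linarith
          · refine Finset.sum_le_sum fun i _ => ?_
            have := mul_le_mul_of_nonneg_right (hT i) hσ
            refine mul_le_mul_of_nonneg_left (mul_le_mul_of_nonneg_left
              (pow_le_pow_left₀ (by positivity) ?_ _) (by positivity)) hσ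
            push_cast
            linarith
      _ = (Fintype.card ι * (c + (m + 1 : ℕ) + T.card * σ) ^ m) * (c + T.card * σ) := by
          rw [Finset.sum_const, nsmul_eq_mul]; ring
      _ ≤ (Fintype.card ι * (c + (m + 1 : ℕ) + T.card * σ) ^ m) * (c + (m + 1 : ℕ) + T.card * σ) := by
          gcongr
          push_cast; linarith [(Nat.cast_nonneg m : (0:ℝ) ≤ m)]
      _ = _ := by ring

/-- normalised vector -/
def auxW (d : ℕ) (g : Fin d → ℝ) : Fin d → ℝ := (enorm2 g)⁻¹ • g

instance (ι : Type*) [Fintype ι] : IsProbabilityMeasure (stdG ι) := by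
  unfold stdG; infer_instance

lemma auxW_meas (d : ℕ) : Measurable (auxW d) := by
  unfold auxW enorm2
  fun_prop

lemma auxW_apply (d : ℕ) (g : Fin d → ℝ) (i : Fin d) : auxW d g i = g i / Real.sqrt (∑ i, (g i)^2) := by
  simp [auxW, enorm2, div_eq_inv_mul]

lemma auxW_sq (d : ℕ) (g : Fin d → ℝ) (i : Fin d) : auxW d g i ^ 2 = g i ^ 2 / ∑ i, (g i)^2 := by
  rw [auxW_apply, div_pow, Real.sq_sqrt (Finset.sum_nonneg fun i _ => sq_nonneg _)]

lemma auxW_sum (d : ℕ) (g : Fin d → ℝ) (h : ∑ i, (g i)^2 ≠ 0) : ∑ i, auxW d g i ^ 2 = 1 := by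
  simp only [auxW_sq, ← Finset.sum_div, div_self h]

lemma auxW_sum_or (d : ℕ) (g : Fin d → ℝ) : ∑ i, auxW d g i ^ 2 = 1 ∨ auxW d g = 0 := by
  by_cases h : ∑ i, (g i)^2 = 0
  · right; ext i; rw [auxW_apply, h]; simp
  · left; exact auxW_sum d g h

lemma auxW_le_one (d : ℕ) (g : Fin d → ℝ) (i : Fin d) : auxW d g i ^ 2 ≤ 1 := by
  rcases auxW_sum_or d g with h | h
  · rw [← h]; exact Finset.single_le_sum (f := fun i => auxW d g i ^ 2) (fun j _ => sq_nonneg _) (Finset.mem_univ i)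
  · simp [h]

lemma auxW_bm (d : ℕ) (i : Fin d) : AuxBM (fun g => auxW d g i) :=
  ⟨(measurable_pi_apply i).comp (auxW_meas d), 1, fun g => by
    rw [← sq_le_one_iff_abs_le_one]; exact auxW_le_one d g i⟩

lemma AuxBM.pow {Ω : Type*} [MeasurableSpace Ω] {f : Ω → ℝ} (hf : AuxBM f) (n : ℕ) :
    AuxBM (fun ω => f ω ^ n) := by
  induction n with
  | zero => simpa using AuxBM.const 1
  | succ n ih => simp only [pow_succ]; exact ih.mul hf

lemma auxW_ae (d : ℕ) (hd : 1 ≤ d) : ∀ᵐ g ∂(stdG (Fin d)), ∑ i, auxW d g i ^ 2 = 1 := by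
  have h : ∀ᵐ x ∂(gaussianReal 0 1), x ≠ 0 := by
    have := nullSingletonClass_gaussianReal (μ := 0) (v := 1) one_ne_zero
    rw [ae_iff]; simp
  let i0 : Fin d := ⟨0, hd⟩
  have h2 : ∀ᵐ g ∂(stdG (Fin d)), g i0 ≠ 0 :=
    (measurePreserving_eval (fun _ : Fin d => gaussianReal 0 1) i0).quasiMeasurePreserving.ae h
  filter_upwards [h2] with g hg
  apply auxW_sum
  have : g i0 ^ 2 ≤ ∑ i, g i ^ 2 :=
    Finset.single_le_sum (f := fun i => g i ^ 2) (fun j _ => sq_nonneg _) (Finset.mem_univ i0)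
  have : 0 < g i0 ^ 2 := by positivity
  linarith

/-- sign flip of coordinate `k` -/
def auxFlip {d : ℕ} (k : Fin d) (w : Fin d → ℝ) : Fin d → ℝ := fun i => if i = k then - w i else w i

lemma auxFlip_mp {d : ℕ} (k : Fin d) : MeasurePreserving (auxFlip k) (stdG (Fin d)) (stdG (Fin d)) := by
  have := measurePreserving_pi (fun _ : Fin d => gaussianReal 0 1) (fun _ => gaussianReal 0 1)
    (f := fun i x => if i = k then - x else x) (fun i => by
      by_cases h : i = k
      · simp only [h, if_true]
        exact ⟨measurable_neg, by rw [gaussianReal_map_neg, neg_zero]⟩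
      · simp only [h, if_false]
        exact MeasurePreserving.id _)
  exact this

lemma auxW_flip {d : ℕ} (k : Fin d) (g : Fin d → ℝ) : auxW d (auxFlip k g) = auxFlip k (auxW d g) := by
  have : ∑ i, (auxFlip k g i)^2 = ∑ i, (g i)^2 := Finset.sum_congr rfl fun i _ => by
    unfold auxFlip; split_ifs <;> ring
  ext i
  simp only [auxW_apply, this]
  unfold auxFlip
  split_ifs <;> simp [auxW_apply, neg_div]

lemma aux_flip_zero {d : ℕ} (k : Fin d) (f : (Fin d → ℝ) → ℝ) (hf : Measurable f)
    (h : ∀ w, f (auxFlip k w) = - f w) : ∫ g, f (auxW d g) ∂(stdG (Fin d)) = 0 := by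
  have h1 := integral_map (μ := stdG (Fin d)) (φ := auxFlip k) (f := fun g => f (auxW d g))
    (auxFlip_mp k).measurable.aemeasurable (hf.comp (auxW_meas d)).aestronglyMeasurable
  rw [(auxFlip_mp k).map_eq] at h1
  simp only [auxW_flip, h, integral_neg] at h1
  linarith

lemma auxPerm_mp {d : ℕ} (τ : Equiv.Perm (Fin d)) :
    MeasurePreserving (fun (g : Fin d → ℝ) i => g (τ i)) (stdG (Fin d)) (stdG (Fin d)) := by
  have := measurePreserving_piCongrLeft (α := fun _ : Fin d => ℝ) (fun _ : Fin d => gaussianReal 0 1) τ.symm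
  unfold stdG
  convert this using 1
  ext g i
  rw [MeasurableEquiv.coe_piCongrLeft]
  have := Equiv.piCongrLeft_apply_apply (fun _ : Fin d => ℝ) τ.symm g (τ i)
  simpa using this.symm

lemma auxW_perm {d : ℕ} (τ : Equiv.Perm (Fin d)) (g : Fin d → ℝ) :
    auxW d (fun i => g (τ i)) = fun i => auxW d g (τ i) := by
  ext i
  simp only [auxW_apply]
  rw [Equiv.sum_comp τ (fun i => g i ^ 2)]

lemma aux_perm_int {d : ℕ} (τ : Equiv.Perm (Fin d)) (f : (Fin d → ℝ) → ℝ) (hf : Measurable f) :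
    ∫ g, f (auxW d g) ∂(stdG (Fin d)) = ∫ g, f (fun i => auxW d g (τ i)) ∂(stdG (Fin d)) := by
  have h1 := integral_map (μ := stdG (Fin d)) (φ := (fun (g : Fin d → ℝ) i => g (τ i)))
    (f := fun g => f (auxW d g))
    (auxPerm_mp τ).measurable.aemeasurable (hf.comp (auxW_meas d)).aestronglyMeasurable
  rw [(auxPerm_mp τ).map_eq] at h1
  simpa only [auxW_perm] using h1

/-- second moment -/
lemma aux_second (d : ℕ) (hd : 1 ≤ d) (i : Fin d) :
    ∫ g, auxW d g i ^ 2 ∂(stdG (Fin d)) = 1 / d := by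
  have h1 : ∀ j, ∫ g, auxW d g j ^ 2 ∂(stdG (Fin d)) = ∫ g, auxW d g i ^ 2 ∂(stdG (Fin d)) := by
    intro j
    have := aux_perm_int (Equiv.swap i j) (fun w => w j ^ 2) (by fun_prop)
    simpa using this
  have h2 : ∑ j, ∫ g, auxW d g j ^ 2 ∂(stdG (Fin d)) = 1 := by
    rw [← integral_finsetSum _ fun j _ => ((auxW_bm d j).pow 2).integrable _]
    rw [integral_congr_ae (g := fun _ => 1) (auxW_ae d hd)]
    simp
  simp only [h1, Finset.sum_const, Finset.card_univ, Fintype.card_fin, nsmul_eq_mul] at h2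
  have : (d : ℝ) ≠ 0 := by positivity
  field_simp
  linarith

/-- fourth moments -/
lemma aux_fourth_eq (d : ℕ) (i j : Fin d) :
    ∫ g, auxW d g i ^ 4 ∂(stdG (Fin d)) = ∫ g, auxW d g j ^ 4 ∂(stdG (Fin d)) := by
  have := aux_perm_int (Equiv.swap i j) (fun w => w i ^ 4) (by fun_prop)
  simpa using this

lemma aux_fourth_mixed_eq (d : ℕ) (i j i' j' : Fin d) (h : i ≠ j) (h' : i' ≠ j') :
    ∫ g, auxW d g i ^ 2 * auxW d g j ^ 2 ∂(stdG (Fin d)) =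
      ∫ g, auxW d g i' ^ 2 * auxW d g j' ^ 2 ∂(stdG (Fin d)) := by
  have h1 := aux_perm_int ((Equiv.swap i i').trans (Equiv.swap (Equiv.swap i i' j) j'))
    (fun w => w i ^ 2 * w j ^ 2) (by fun_prop)
  have h2 : Equiv.swap (Equiv.swap i i' j) j' i' = i' := by
    apply Equiv.swap_apply_of_ne_of_ne _ h'
    intro h3
    apply h
    have := congrArg (Equiv.swap i i') h3
    simpa using this
  simpa [h2] using h1

lemma aux_fourth_facts (d : ℕ) (hd : 1 ≤ d) : ∃ α β : ℝ, 0 ≤ β ∧ β ≤ α ∧ d ^ 2 * β ≤ 1 ∧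
    (∀ i, ∫ g, auxW d g i ^ 4 ∂(stdG (Fin d)) = α) ∧
    (∀ i j, i ≠ j → ∫ g, auxW d g i ^ 2 * auxW d g j ^ 2 ∂(stdG (Fin d)) = β) := by
  let i0 : Fin d := ⟨0, hd⟩
  set α := ∫ g, auxW d g i0 ^ 4 ∂(stdG (Fin d)) with hα
  have hα' : ∀ i, ∫ g, auxW d g i ^ 4 ∂(stdG (Fin d)) = α := fun i => aux_fourth_eq d i i0
  by_cases h : ∃ i j : Fin d, i ≠ j
  · obtain ⟨i1, j1, h1⟩ := h
    set β := ∫ g, auxW d g i1 ^ 2 * auxW d g j1 ^ 2 ∂(stdG (Fin d)) with hβ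
    have hβ' : ∀ i j, i ≠ j → ∫ g, auxW d g i ^ 2 * auxW d g j ^ 2 ∂(stdG (Fin d)) = β :=
      fun i j h => aux_fourth_mixed_eq d i j i1 j1 h h1
    have hle : β ≤ α := by
      have : 2 * β ≤ ∫ g, (auxW d g i1 ^ 4 + auxW d g j1 ^ 4) ∂(stdG (Fin d)) := by
        rw [hβ, ← integral_const_mul]
        apply integral_mono
        · exact ((AuxBM.const 2).mul (((auxW_bm d i1).pow 2).mul ((auxW_bm d j1).pow 2))).integrable _
        · exact (((auxW_bm d i1).pow 4).add ((auxW_bm d j1).pow 4)).integrable _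
        · intro g
          simp only
          nlinarith [sq_nonneg (auxW d g i1 ^ 2 - auxW d g j1 ^ 2)]
      rw [integral_add (((auxW_bm d i1).pow 4).integrable _) (((auxW_bm d j1).pow 4).integrable _),
        hα', hα'] at this
      linarith
    refine ⟨α, β, integral_nonneg fun g => by positivity, hle, ?_, hα', hβ'⟩
    have e : ∫ g, (∑ i, auxW d g i ^ 2) * (∑ i, auxW d g i ^ 2) ∂(stdG (Fin d)) = 1 := by
      rw [integral_congr_ae (g := fun _ => 1)]
      · simp
      · filter_upwards [auxW_ae d hd] with g hg
        rw [hg, one_mul]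
    simp only [Finset.sum_mul_sum] at e
    rw [integral_finsetSum _ fun i _ => (AuxBM.sum _ fun j _ => ((auxW_bm d i).pow 2).mul ((auxW_bm d j).pow 2)).integrable _] at e
    rw [← e]
    calc (d:ℝ)^2 * β = ∑ i : Fin d, ∑ j : Fin d, β := by simp; ring
      _ ≤ _ := by
        refine Finset.sum_le_sum fun i _ => ?_
        rw [integral_finsetSum _ fun j _ => (((auxW_bm d i).pow 2).mul ((auxW_bm d j).pow 2)).integrable _]
        refine Finset.sum_le_sum fun j _ => ?_
        by_cases hij : i = j
        · subst hij
          have : ∀ g, auxW d g i ^ 2 * auxW d g i ^ 2 = auxW d g i ^ 4 := fun g => by ring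
          simp only [this, hα']
          exact hle
        · rw [hβ' i j hij]
  · push Not at h
    exact ⟨α, 0, le_rfl, integral_nonneg fun g => by positivity, by simp, hα', fun i j hij => absurd (h i j) hij⟩

lemma aux_alpha : ∃ A : ℝ, 0 < A ∧ ∀ d : ℕ, 1 ≤ d → ∀ i : Fin d,
    ∫ g, auxW d g i ^ 4 ∂(stdG (Fin d)) ≤ A / d ^ 2 := by
  set γ := gaussianReal 0 1
  set ρ := ∫ x, Real.exp (-x^2) ∂γ with hρ
  have hIntg : Integrable (fun x : ℝ => Real.exp (-x^2)) γ := by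
    refine Integrable.of_bound (by fun_prop) 1 (Filter.Eventually.of_forall fun x => ?_)
    rw [Real.norm_eq_abs, Real.abs_exp]
    exact Real.exp_le_one_iff.2 (by nlinarith [sq_nonneg x])
  have hρ0 : 0 ≤ ρ := integral_nonneg fun x => (Real.exp_pos _).le
  have hρ1 : ρ < 1 := by
    have hIntg' : Integrable (fun x : ℝ => 1 - Real.exp (-x^2)) γ := (integrable_const 1).sub hIntg
    have : 0 < ∫ x, (1 - Real.exp (-x^2)) ∂γ := by
      rw [integral_pos_iff_support_of_nonneg _ hIntg']
      · have h1 : ({0}ᶜ : Set ℝ) ⊆ Function.support (fun x : ℝ => 1 - Real.exp (-x^2)) := by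
          intro x hx
          have hx : x ≠ 0 := hx
          have : Real.exp (-x^2) < 1 := by
            have h0 : 0 < x^2 := by positivity
            rw [← Real.exp_zero]
            exact Real.exp_lt_exp.2 (by linarith)
          simp only [Function.mem_support]
          linarith
        refine lt_of_lt_of_le ?_ (measure_mono h1)
        have := nullSingletonClass_gaussianReal (μ := 0) (v := 1) one_ne_zero
        rw [measure_compl (measurableSet_singleton 0) (by simp)]
        simp [γ]
      · intro x
        simp only [Pi.zero_apply, sub_nonneg]
        exact Real.exp_le_one_iff.2 (by nlinarith [sq_nonneg x])
    rw [integral_sub (integrable_const 1) hIntg] at this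
    simp at this
    linarith
  set r := (1 + ρ) / 2 with hr
  have hr0 : 0 < r := by linarith
  have hr1 : r < 1 := by linarith
  set c := - Real.log r with hc
  have hc0 : 0 < c := by have := Real.log_neg hr0 hr1; linarith
  have hec : Real.exp c = r⁻¹ := by rw [hc, Real.exp_neg, Real.exp_log hr0]
  set q := Real.exp c * ρ with hq
  have hq0 : 0 ≤ q := by positivity
  have hq1 : q < 1 := by
    rw [hq, hec, inv_mul_lt_iff₀ hr0]; linarith
  obtain ⟨B, hB⟩ := (tendsto_pow_const_mul_const_pow_of_lt_one 2 hq0 hq1).bddAbove_range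
  have hB' : ∀ d : ℕ, (d:ℝ)^2 * q^d ≤ B := fun d => hB ⟨d, rfl⟩
  have hB0 : 0 ≤ B := by have := hB' 0; simpa using this
  have h4 : Integrable (fun x : ℝ => x ^ 4) γ := by
    have := (memLp_id_gaussianReal (μ := 0) (v := 1) 4).integrable_norm_pow (by norm_num)
    have e : ∀ x : ℝ, |x| ^ 4 = x ^ 4 := fun x => Even.pow_abs (by decide) x
    simpa [e] using this
  set M := ∫ x, x^4 ∂γ
  have hM0 : 0 ≤ M := integral_nonneg fun x => by positivity
  refine ⟨M / c^2 + B + 1, by positivity, fun d hd i => ?_⟩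
  have hd0 : (0:ℝ) < d := by exact_mod_cast hd
  have mp := measurePreserving_eval (fun _ : Fin d => gaussianReal 0 1) i
  have hi4 : Integrable (fun g : Fin d → ℝ => g i ^ 4) (stdG (Fin d)) :=
    mp.integrable_comp_of_integrable h4
  have hI4 : ∫ g, g i ^ 4 ∂(stdG (Fin d)) = M := by
    have := integral_map (μ := stdG (Fin d)) (φ := fun g => g i) (f := fun x : ℝ => x ^ 4)
      (measurable_pi_apply i).aemeasurable (by fun_prop)
    rw [← this]
    have h2 := mp.map_eq
    change Measure.map (fun g => g i) (stdG (Fin d)) = _ at h2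
    rw [h2]
  have hIe : ∫ g, Real.exp (c * d - ∑ j, g j ^ 2) ∂(stdG (Fin d)) = q ^ d := by
    have e : ∀ g : Fin d → ℝ, Real.exp (c * d - ∑ j, g j ^ 2) = ∏ j, (Real.exp c * Real.exp (- g j ^ 2)) := by
      intro g
      simp only [← Real.exp_add, ← Real.exp_sum, Finset.sum_add_distrib, Finset.sum_neg_distrib]
      congr 1
      simp; ring
    simp only [e]
    unfold stdG
    rw [integral_fintype_prod_eq_prod (f := fun _ x => Real.exp c * Real.exp (- x ^ 2))]
    simp only [integral_const_mul]
    rw [Finset.prod_const]; simp [hq, hρ, γ]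
  have hie : Integrable (fun g : Fin d → ℝ => Real.exp (c * d - ∑ j, g j ^ 2)) (stdG (Fin d)) := by
    have hm : Measurable (fun g : Fin d → ℝ => Real.exp (c * d - ∑ j, g j ^ 2)) := by fun_prop
    refine Integrable.of_bound hm.aestronglyMeasurable (Real.exp (c * d)) (Filter.Eventually.of_forall fun x => ?_)
    rw [Real.norm_eq_abs, Real.abs_exp]
    exact Real.exp_le_exp.2 (by have : 0 ≤ ∑ j, x j ^ 2 := Finset.sum_nonneg fun _ _ => sq_nonneg _
                                linarith)
  calc _ ≤ ∫ g, (((c * d)^2)⁻¹ * g i ^ 4 + Real.exp (c * d - ∑ j, g j ^ 2)) ∂(stdG (Fin d)) := by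
        apply integral_mono (((auxW_bm d i).pow 4).integrable _) ((hi4.const_mul _).add hie)
        intro g
        change auxW d g i ^ 4 ≤ ((c * d)^2)⁻¹ * g i ^ 4 + Real.exp (c * d - ∑ j, g j ^ 2)
        by_cases hs : c * d ≤ ∑ j, g j ^ 2
        · have e : auxW d g i ^ 4 = ((∑ j, g j ^ 2)^2)⁻¹ * g i ^ 4 := by
            rw [show auxW d g i ^ 4 = (auxW d g i ^ 2)^2 by ring, auxW_sq, div_pow]
            field_simp
          rw [e]
          have : ((∑ j, g j ^ 2)^2)⁻¹ * g i ^ 4 ≤ ((c * d)^2)⁻¹ * g i ^ 4 := by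
            gcongr
          linarith [Real.exp_pos (c * d - ∑ j, g j ^ 2)]
        · push Not at hs
          have h1 : auxW d g i ^ 4 ≤ 1 := by
            have := auxW_le_one d g i
            nlinarith [sq_nonneg (auxW d g i)]
          have h2 : 1 ≤ Real.exp (c * d - ∑ j, g j ^ 2) := Real.one_le_exp (by linarith)
          have h3 : 0 ≤ ((c * d)^2)⁻¹ * g i ^ 4 := by positivity
          linarith
    _ = ((c * d)^2)⁻¹ * M + q ^ d := by
        rw [integral_add (hi4.const_mul _) hie, integral_const_mul, hI4, hIe]
    _ ≤ _ := by
        rw [le_div_iff₀ (by positivity)]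
        have := hB' d
        have e : (((c * d)^2)⁻¹ * M + q ^ d) * d^2 = M / c^2 + d^2 * q^d := by
          field_simp
        rw [e]; linarith

lemma aux_sum_succ {d n : ℕ} (κ : Fin d → ℕ) (h : ∑ i, κ i = n + 1) :
    ∃ i, ∃ κ' : Fin d → ℕ, κ = κ' + Pi.single i 1 ∧ ∑ i, κ' i = n := by
  have : ∃ i, κ i ≠ 0 := by
    by_contra hc
    push Not at hc
    simp [hc] at h
  obtain ⟨i, hi⟩ := this
  have e : κ = (κ - Pi.single i 1) + Pi.single i 1 := by
    ext k
    by_cases hk : k = i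
    · subst hk; simp; omega
    · simp [hk]
  refine ⟨i, κ - Pi.single i 1, e, ?_⟩
  have h2 := h
  rw [e] at h2
  simp only [Pi.add_apply, Finset.sum_add_distrib, Finset.sum_pi_single'] at h2
  simp at h2
  exact h2

lemma aux_repr {d : ℕ} (κ : MIdx d 2) : ∃ i j, κ.1 = Pi.single i 1 + Pi.single j 1 := by
  have h := Finset.Nat.mem_antidiagonalTuple.1 κ.2
  obtain ⟨i, κ', e, h'⟩ := aux_sum_succ κ.1 h
  obtain ⟨j, κ'', e', h''⟩ := aux_sum_succ κ' h'
  have : κ'' = 0 := by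
    ext k
    exact (Finset.sum_eq_zero_iff.1 h'') k (Finset.mem_univ k)
  refine ⟨j, i, ?_⟩
  rw [e, e', this, zero_add]

lemma aux_cases {d : ℕ} (κ : MIdx d 2) : (∃ i, κ.1 = Pi.single i 2) ∨
    ∃ i j, i ≠ j ∧ κ.1 = Pi.single i 1 + Pi.single j 1 := by
  obtain ⟨i, j, h⟩ := aux_repr κ
  by_cases hij : i = j
  · left
    refine ⟨i, ?_⟩
    rw [h, hij, ← Pi.single_add]
  · exact Or.inr ⟨i, j, hij, h⟩

lemma aux_card (d : ℕ) : Fintype.card (MIdx d 2) ≤ d ^ 2 := by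
  choose a b h using fun κ : MIdx d 2 => aux_repr κ
  have : Function.Injective (fun κ : MIdx d 2 => (a κ, b κ)) := by
    intro κ κ' e
    simp only [Prod.mk.injEq] at e
    apply Subtype.ext
    rw [h κ, h κ', e.1, e.2]
  have := Fintype.card_le_of_injective _ this
  simpa [sq] using this

lemma aux_q_diag {d : ℕ} (κ : MIdx d 2) (i : Fin d) (h : κ.1 = Pi.single i 2) (w : Fin d → ℝ) :
    qvec d 2 w κ = w i ^ 2 := by
  unfold qvec
  rw [h]
  have h1 : ∏ k, ((Nat.factorial ((Pi.single i 2 : Fin d → ℕ) k) : ℕ) : ℝ) = 2 := by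
    rw [Finset.prod_eq_single i]
    · simp
    · intro k _ hk; simp [hk]
    · simp
  have h2 : ∏ k, w k ^ ((Pi.single i 2 : Fin d → ℕ) k) = w i ^ 2 := by
    rw [Finset.prod_eq_single i]
    · simp
    · intro k _ hk; simp [hk]
    · simp
  rw [h1, h2]
  simp

lemma aux_e_diag {d : ℕ} (κ : MIdx d 2) (i : Fin d) (h : κ.1 = Pi.single i 2) : eC d κ = 1 := by
  unfold eC
  rw [if_pos ⟨i, by rw [h]; simp⟩]

lemma aux_off_le {d : ℕ} (i j : Fin d) (hij : i ≠ j) (k : Fin d) :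
    (Pi.single i 1 + Pi.single j 1 : Fin d → ℕ) k ≤ 1 := by
  simp only [Pi.add_apply, Pi.single_apply]
  split_ifs with h1 h2
  · exact absurd (h1.symm.trans h2) hij
  all_goals simp

lemma aux_q_off {d : ℕ} (κ : MIdx d 2) (i j : Fin d) (hij : i ≠ j)
    (h : κ.1 = Pi.single i 1 + Pi.single j 1) (w : Fin d → ℝ) :
    qvec d 2 w κ = Real.sqrt 2 * (w i * w j) := by
  unfold qvec
  rw [h]
  have h1 : ∏ k, ((Nat.factorial ((Pi.single i 1 + Pi.single j 1 : Fin d → ℕ) k) : ℕ) : ℝ) = 1 := by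
    refine Finset.prod_eq_one fun k _ => ?_
    rw [Nat.factorial_eq_one.2 (aux_off_le i j hij k), Nat.cast_one]
  have h3 : ∀ i, ∏ k, w k ^ ((Pi.single i 1 : Fin d → ℕ) k) = w i := by
    intro i
    rw [Finset.prod_eq_single i]
    · simp
    · intro k _ hk; simp [hk]
    · simp
  have h2 : ∏ k, w k ^ ((Pi.single i 1 + Pi.single j 1 : Fin d → ℕ) k) = w i * w j := by
    simp only [Pi.add_apply, pow_add, Finset.prod_mul_distrib, h3]
  rw [h1, h2]
  simp

lemma aux_e_off {d : ℕ} (κ : MIdx d 2) (i j : Fin d) (hij : i ≠ j)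
    (h : κ.1 = Pi.single i 1 + Pi.single j 1) : eC d κ = 0 := by
  unfold eC
  rw [if_neg]
  rintro ⟨k, hk⟩
  have := aux_off_le i j hij k
  rw [h] at hk
  omega

/-- centred feature vector -/
def auxX (d : ℕ) (w : Fin d → ℝ) (κ : MIdx d 2) : ℝ := qvec d 2 w κ - (1 / (d : ℝ)) * eC d κ

lemma auxX_flip {d : ℕ} (k : Fin d) (w : Fin d → ℝ) (κ : MIdx d 2) :
    auxX d (auxFlip k w) κ = (-1) ^ (κ.1 k) * auxX d w κ := by
  rcases aux_cases κ with ⟨i, hi⟩ | ⟨i, j, hij, h⟩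
  · unfold auxX
    rw [aux_q_diag κ i hi, aux_q_diag κ i hi, hi]
    unfold auxFlip
    by_cases hk : i = k
    · subst hk; simp
    · rw [if_neg hk]; simp [Ne.symm hk]
  · unfold auxX
    rw [aux_q_off κ i j hij h, aux_q_off κ i j hij h, aux_e_off κ i j hij h, h]
    unfold auxFlip
    by_cases hk : i = k
    · subst hk; simp [Ne.symm hij, hij]
    · by_cases hk' : j = k
      · subst hk'; simp [hij, Ne.symm hij]
      · simp [hk, hk', Ne.symm hk, Ne.symm hk']

lemma aux_q_meas (d : ℕ) (κ : MIdx d 2) : Measurable (fun w => qvec d 2 w κ) := by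
  unfold qvec; fun_prop

lemma auxX_meas (d : ℕ) (κ : MIdx d 2) : Measurable (fun w => auxX d w κ) :=
  (aux_q_meas d κ).sub measurable_const

lemma auxX_mean (d : ℕ) (hd : 1 ≤ d) (κ : MIdx d 2) :
    ∫ w, qvec d 2 w κ ∂(unifSphere (Fin d)) = (1 / (d : ℝ)) * eC d κ := by
  unfold unifSphere
  have := integral_map (μ := stdG (Fin d)) (φ := auxW d) (f := fun w => qvec d 2 w κ)
    (auxW_meas d).aemeasurable (aux_q_meas d κ).aestronglyMeasurable
  refine this.trans ?_
  rcases aux_cases κ with ⟨i, hi⟩ | ⟨i, j, hij, h⟩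
  · simp only [aux_q_diag κ i hi, aux_e_diag κ i hi, aux_second d hd, mul_one]
  · rw [aux_e_off κ i j hij h, mul_zero]
    refine aux_flip_zero i _ (aux_q_meas d κ) fun w => ?_
    have := auxX_flip i w κ
    unfold auxX at this
    rw [aux_e_off κ i j hij h, h] at this
    simpa [hij] using this

lemma aux_sum_eC (d : ℕ) (f : MIdx d 2 → ℝ) (F : Fin d → ℝ)
    (hF : ∀ κ i, κ.1 = Pi.single i 2 → f κ = F i) : ∑ κ, f κ * eC d κ = ∑ i, F i := by
  symm
  have hm : ∀ i : Fin d, (Pi.single i 2 : Fin d → ℕ) ∈ Finset.Nat.antidiagonalTuple d 2 := by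
    intro i
    rw [Finset.Nat.mem_antidiagonalTuple]
    simp
  refine Fintype.sum_of_injective (fun i => (⟨Pi.single i 2, hm i⟩ : MIdx d 2)) ?_ _ _ ?_ ?_
  · intro i j h
    have h1 := congrFun (congrArg Subtype.val h) i
    by_contra hij
    simp [hij] at h1
  · intro κ hκ
    rcases aux_cases κ with ⟨i, hi⟩ | ⟨i, j, hij, h⟩
    · exact absurd ⟨i, Subtype.ext hi.symm⟩ hκ
    · rw [aux_e_off κ i j hij h, mul_zero]
  · intro i
    rw [aux_e_diag _ i rfl, mul_one, hF _ i rfl]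

lemma aux_sum_q (d : ℕ) (w : Fin d → ℝ) : ∑ κ : MIdx d 2, qvec d 2 w κ ^ 2 = (∑ i, w i ^ 2) ^ 2 := by
  rw [Finset.sum_pow_eq_sum_piAntidiag, Finset.piAntidiag_univ_fin_eq_antidiagonalTuple]
  refine Eq.trans ?_ (Finset.sum_coe_sort (Finset.Nat.antidiagonalTuple d 2) _)
  refine Finset.sum_congr rfl fun κ _ => ?_
  unfold qvec
  rw [mul_pow, Real.sq_sqrt (by positivity)]
  congr 1
  · unfold Nat.multinomial
    rw [Nat.cast_div (Nat.prod_factorial_dvd_factorial_sum _ _) (by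
      exact_mod_cast Finset.prod_ne_zero_iff.2 fun i _ => Nat.factorial_ne_zero _),
      Finset.Nat.mem_antidiagonalTuple.1 κ.2, Nat.cast_prod]
  · rw [← Finset.prod_pow]
    exact Finset.prod_congr rfl fun i _ => by rw [← pow_mul, ← pow_mul, mul_comm]

lemma auxX_norm (d : ℕ) (hd : 1 ≤ d) (g : Fin d → ℝ) : ∑ κ, auxX d (auxW d g) κ ^ 2 ≤ 1 := by
  set w := auxW d g with hw
  have hee : ∀ κ, eC d κ ^ 2 = eC d κ := by intro κ; unfold eC; split_ifs <;> simp
  have e : ∀ κ, auxX d w κ ^ 2 = qvec d 2 w κ ^ 2 + ((1/(d:ℝ))^2 - 2 / d * qvec d 2 w κ) * eC d κ := by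
    intro κ
    unfold auxX
    have := hee κ
    linear_combination (1/(d:ℝ))^2 * this
  simp only [e, Finset.sum_add_distrib]
  rw [aux_sum_q, aux_sum_eC d _ (fun i => (1/(d:ℝ))^2 - 2 / d * w i ^ 2)
    (fun κ i h => by rw [aux_q_diag κ i h])]
  rw [Finset.sum_sub_distrib, ← Finset.mul_sum]
  have hd1 : (1:ℝ) ≤ d := by exact_mod_cast hd
  have hd0 : (d:ℝ) ≠ 0 := by positivity
  have h3 : ∑ i : Fin d, (1/(d:ℝ))^2 = 1/(d:ℝ) := by
    simp; field_simp
  have h4 : 1/(d:ℝ) ≤ 1 := by rw [div_le_one (by positivity)]; exact hd1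
  have h5 : 0 ≤ 1/(d:ℝ) := by positivity
  rw [h3]
  rcases auxW_sum_or d g with h | h
  · rw [← hw] at h; rw [h]
    have : 2 / (d:ℝ) = 2 * (1/d) := by ring
    rw [this]; linarith
  · rw [← hw] at h; rw [h]
    simpa using h4

lemma auxX_bm (d : ℕ) (hd : 1 ≤ d) (κ : MIdx d 2) : AuxBM (fun g => auxX d (auxW d g) κ) :=
  ⟨(auxX_meas d κ).comp (auxW_meas d), 1, fun g => by
    rw [← sq_le_one_iff_abs_le_one]
    exact (Finset.single_le_sum (f := fun κ => auxX d (auxW d g) κ ^ 2) (fun j _ => sq_nonneg _)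
      (Finset.mem_univ κ)).trans (auxX_norm d hd g)⟩

lemma aux_cov_zero {d : ℕ} (κ κ' : MIdx d 2) (k : Fin d) (hk : Odd (κ.1 k + κ'.1 k)) :
    ∫ g, auxX d (auxW d g) κ * auxX d (auxW d g) κ' ∂(stdG (Fin d)) = 0 := by
  refine aux_flip_zero k (fun w => auxX d w κ * auxX d w κ') ((auxX_meas d κ).mul (auxX_meas d κ')) fun w => ?_
  rw [auxX_flip, auxX_flip]
  have : ((-1:ℝ)) ^ (κ.1 k) * (-1) ^ (κ'.1 k) = -1 := by rw [← pow_add]; exact hk.neg_one_pow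
  linear_combination (auxX d w κ * auxX d w κ') * this

lemma aux_cov_off {d : ℕ} (κ κ' : MIdx d 2) (i j : Fin d) (hij : i ≠ j)
    (h : κ.1 = Pi.single i 1 + Pi.single j 1) (hne : κ ≠ κ') : ∃ k, Odd (κ.1 k + κ'.1 k) := by
  by_contra hc
  push Not at hc
  have hle : ∀ k ∈ Finset.univ, κ.1 k ≤ κ'.1 k := by
    intro k _
    have h1 := aux_off_le i j hij k
    rw [← h] at h1
    have h2 := hc k
    rw [Nat.not_odd_iff_even, Nat.even_add, Nat.even_iff, Nat.even_iff] at h2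
    omega
  have hs : ∑ k, κ.1 k = ∑ k, κ'.1 k := by
    rw [Finset.Nat.mem_antidiagonalTuple.1 κ.2, Finset.Nat.mem_antidiagonalTuple.1 κ'.2]
  have := (Finset.sum_eq_sum_iff_of_le hle).1 hs
  exact hne (Subtype.ext (funext fun k => this k (Finset.mem_univ k)))

lemma aux_cov (d : ℕ) (hd : 1 ≤ d) (A : ℝ)
    (hA : ∀ i : Fin d, ∫ g, auxW d g i ^ 4 ∂(stdG (Fin d)) ≤ A / d ^ 2)
    (M : Matrix (MIdx d 2) (MIdx d 2) ℝ) (hM : M.PosSemidef) :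
    ∑ k, ∑ l, (∫ g, auxX d (auxW d g) k * auxX d (auxW d g) l ∂(stdG (Fin d))) * M k l ≤
      (2 * A / d ^ 2) * M.trace := by
  obtain ⟨α, β, hβ0, hβα, hdβ, hα, hβ⟩ := aux_fourth_facts d hd
  have hαA : α ≤ A / d ^ 2 := by rw [← hα ⟨0, hd⟩]; exact hA _
  have hd0 : (0:ℝ) < d := by exact_mod_cast hd
  set b := β - (1/(d:ℝ))^2 with hb
  have hb0 : b ≤ 0 := by
    rw [hb, sub_nonpos, div_pow, one_pow, le_div_iff₀ (by positivity)]; linarith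
  have hbm := fun i => auxW_bm d i
  have hdd : ∀ i j, ∫ g, (auxW d g i ^ 2 - 1/(d:ℝ)) * (auxW d g j ^ 2 - 1/(d:ℝ)) ∂(stdG (Fin d)) =
      (∫ g, auxW d g i ^ 2 * auxW d g j ^ 2 ∂(stdG (Fin d))) - (1/(d:ℝ))^2 := by
    intro i j
    have e : ∀ g, (auxW d g i ^ 2 - 1/(d:ℝ)) * (auxW d g j ^ 2 - 1/(d:ℝ)) =
        auxW d g i ^ 2 * auxW d g j ^ 2 + ((-(1/(d:ℝ))) * auxW d g i ^ 2 +
          ((-(1/(d:ℝ))) * auxW d g j ^ 2 + (1/(d:ℝ))^2)) := fun g => by ring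
    have m1 := ((hbm i).pow 2).mul ((hbm j).pow 2)
    have m2 := (AuxBM.const (-(1/(d:ℝ)))).mul ((hbm i).pow 2)
    have m3 := (AuxBM.const (-(1/(d:ℝ)))).mul ((hbm j).pow 2)
    have m4 := AuxBM.const (Ω := Fin d → ℝ) ((1/(d:ℝ))^2)
    simp only [e]
    rw [integral_add (m1.integrable _) ((m2.add (m3.add m4)).integrable _),
      integral_add (m2.integrable _) ((m3.add m4).integrable _),
      integral_add (m3.integrable _) (m4.integrable _), integral_const_mul, integral_const_mul,
      aux_second d hd, aux_second d hd]
    simp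
    ring
  let cf : MIdx d 2 → ℝ := fun κ => if eC d κ = 1 then α - β else 2 * β
  have hcf : ∀ κ, cf κ ≤ 2 * A / d^2 := by
    intro κ
    have : 2 * A / (d:ℝ)^2 = 2 * (A / d^2) := by ring
    simp only [cf]
    split_ifs <;> linarith
  have hcov : ∀ k l, (∫ g, auxX d (auxW d g) k * auxX d (auxW d g) l ∂(stdG (Fin d))) =
      (if k = l then cf k else 0) + b * (eC d k * eC d l) := by
    intro k l
    rcases aux_cases k with ⟨i, hi⟩ | ⟨i, j, hij, h⟩
    · rcases aux_cases l with ⟨i', hi'⟩ | ⟨i', j', hij', h'⟩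
      · have e1 := aux_e_diag k i hi
        have e2 := aux_e_diag l i' hi'
        simp only [auxX, aux_q_diag k i hi, aux_q_diag l i' hi', e1, e2, mul_one, hdd, cf, if_true]
        by_cases hii : i = i'
        · subst hii
          rw [if_pos (Subtype.ext (hi.trans hi'.symm))]
          have : ∀ g, auxW d g i ^ 2 * auxW d g i ^ 2 = auxW d g i ^ 4 := fun g => by ring
          simp only [this, hα]
          rw [hb]; ring
        · rw [if_neg, hβ i i' hii, hb]
          · ring
          · intro hkl
            have := congrFun (hi.symm.trans ((congrArg Subtype.val hkl).trans hi')) i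
            simp [hii] at this
      · have hne : l ≠ k := by
          intro hkl
          have e1 := aux_e_diag k i hi
          rw [← hkl, aux_e_off l i' j' hij' h'] at e1
          norm_num at e1
        obtain ⟨m, hm⟩ := aux_cov_off l k i' j' hij' h' hne
        rw [add_comm] at hm
        rw [aux_cov_zero k l m hm, aux_e_off l i' j' hij' h', if_neg (Ne.symm hne)]
        simp
    · have e1 := aux_e_off k i j hij h
      by_cases hkl : k = l
      · subst hkl
        simp only [auxX, aux_q_off k i j hij h, e1, cf, if_true]
        have : ∀ g, (Real.sqrt 2 * (auxW d g i * auxW d g j) - 1 / (d:ℝ) * 0) *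
            (Real.sqrt 2 * (auxW d g i * auxW d g j) - 1 / (d:ℝ) * 0) =
              2 * (auxW d g i ^ 2 * auxW d g j ^ 2) := by
          intro g
          have := Real.mul_self_sqrt (show (0:ℝ) ≤ 2 by norm_num)
          linear_combination (auxW d g i ^ 2 * auxW d g j ^ 2) * this
        simp only [this, integral_const_mul, hβ i j hij]
        norm_num
      · obtain ⟨m, hm⟩ := aux_cov_off k l i j hij h hkl
        rw [aux_cov_zero k l m hm, e1, if_neg hkl]
        simp
  have hsum : ∑ k, ∑ l, (∫ g, auxX d (auxW d g) k * auxX d (auxW d g) l ∂(stdG (Fin d))) * M k l =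
      ∑ k, cf k * M k k + b * (eC d ⬝ᵥ (M.mulVec (eC d))) := by
    simp only [hcov, add_mul, Finset.sum_add_distrib, ite_mul, zero_mul]
    congr 1
    · refine Finset.sum_congr rfl fun k _ => by simp
    · simp only [dotProduct, Matrix.mulVec, Finset.mul_sum]
      exact Finset.sum_congr rfl fun k _ => Finset.sum_congr rfl fun l _ => by ring
  rw [hsum]
  have h1 : 0 ≤ eC d ⬝ᵥ (M.mulVec (eC d)) := by
    simpa using hM.dotProduct_mulVec_nonneg (eC d)
  have h2 : ∑ k, cf k * M k k ≤ (2 * A / d ^ 2) * M.trace := by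
    rw [Matrix.trace, Finset.mul_sum]
    exact Finset.sum_le_sum fun k _ => mul_le_mul_of_nonneg_right (hcf k) hM.diag_nonneg
  nlinarith [mul_nonneg_of_nonpos_of_nonpos hb0 (neg_nonpos.2 h1)]

lemma aux_opNorm {d p : ℕ} (hd : 1 ≤ d) (g : Fin p → Fin d → ℝ) (m : ℕ) (hm : m ≠ 0) (t : ℝ) (ht : 0 ≤ t)
    (h : (auxS (fun g => auxX d (auxW d g)) Finset.univ g ^ m).trace ≤ t ^ m) :
    (opNorm fun (j : Fin p) (κ : MIdx d 2) =>
        qvec d 2 (auxW d (g j)) κ - (1 / (d : ℝ)) * eC d κ) ^ 2 ≤ t := by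
  have h0 : 0 ≤ opNorm fun (j : Fin p) (κ : MIdx d 2) =>
        qvec d 2 (auxW d (g j)) κ - (1 / (d : ℝ)) * eC d κ :=
    Real.iSup_nonneg fun v => Real.sqrt_nonneg _
  have h1 : (opNorm fun (j : Fin p) (κ : MIdx d 2) =>
        qvec d 2 (auxW d (g j)) κ - (1 / (d : ℝ)) * eC d κ) ≤ Real.sqrt t := by
    unfold opNorm
    haveI : Nonempty {v : MIdx d 2 → ℝ // (∑ j, (v j) ^ 2) ≤ 1} := ⟨⟨0, by simp⟩⟩
    refine ciSup_le fun v => Real.sqrt_le_sqrt ?_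
    have := aux_trace_bound _ (auxS_psd (fun g => auxX d (auxW d g)) Finset.univ g) m hm t ht h v.1 v.2
    refine le_trans (le_of_eq ?_) this
    unfold auxS
    rw [Matrix.sum_mulVec, dotProduct_sum]
    refine Finset.sum_congr rfl fun j _ => ?_
    rw [Matrix.vecMulVec_mulVec]
    simp only [dotProduct, auxX, sq, Pi.smul_apply, MulOpposite.smul_eq_mul_unop, MulOpposite.unop_op]
    rw [Finset.sum_mul]
    exact Finset.sum_congr rfl fun κ _ => by ring
  calc _ ≤ (Real.sqrt t) ^ 2 := by gcongr
    _ = t := Real.sq_sqrt ht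

theorem V2_spike_decomposition (D0 : ℝ) (hD0 : 0 < D0) :
    (∀ d : ℕ, 1 ≤ d → ∀ κ : MIdx d 2,
      (∫ w, qvec d 2 w κ ∂(unifSphere (Fin d))) = (1 / (d : ℝ)) * eC d κ) ∧
    ∃ C K : ℝ, 0 < C ∧ 0 < K ∧
      ∀ d p : ℕ, 3 ≤ d → 1 ≤ p →
        1 - ENNReal.ofReal (C * (d : ℝ) ^ (-D0)) ≤
          (Measure.pi fun _ : Fin p => unifSphere (Fin d))
            {w | (opNorm fun (j : Fin p) (κ : MIdx d 2) =>
                    qvec d 2 (w j) κ - (1 / (d : ℝ)) * eC d κ) ^ 2 ≤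
                  Real.log d ^ K * max 1 ((p : ℝ) / (d : ℝ) ^ 2)} := by
  refine ⟨fun d hd κ => auxX_mean d hd κ, ?_⟩
  obtain ⟨A, hA0, hA⟩ := aux_alpha
  set B := D0 + 3 + 2 * A with hB
  have hB0 : 0 < B := by positivity
  refine ⟨Real.exp (D0 * (Real.exp 1 * B)), 2, Real.exp_pos _, two_pos, fun d p hd hp => ?_⟩
  have hd1 : 1 ≤ d := by omega
  have hd0 : (0:ℝ) < d := by exact_mod_cast hd1
  set L := Real.log d with hL
  have hdL : ∀ s : ℝ, (d:ℝ) ^ s = Real.exp (L * s) := fun s => Real.rpow_def_of_pos hd0 s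
  have hL1 : 1 ≤ L := by
    rw [hL, Real.le_log_iff_exp_le hd0]
    have : (3:ℝ) ≤ d := by exact_mod_cast hd
    linarith [Real.exp_one_lt_d9]
  by_cases hsmall : L < Real.exp 1 * B
  · have : 1 ≤ Real.exp (D0 * (Real.exp 1 * B)) * (d : ℝ) ^ (-D0) := by
      rw [hdL, ← Real.exp_add]
      apply Real.one_le_exp
      nlinarith
    rw [tsub_eq_zero_of_le (by simpa using this)]
    exact zero_le
  push Not at hsmall
  set Mx := max 1 ((p : ℝ) / (d : ℝ) ^ 2) with hMx
  have hMx1 : 1 ≤ Mx := le_max_left _ _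
  have hMx2 : (p:ℝ) / d^2 ≤ Mx := le_max_right _ _
  set t := L ^ (2:ℝ) * Mx with ht
  have hL2 : L ^ (2:ℝ) = L ^ 2 := by norm_cast
  have ht0 : 0 < t := by rw [ht, hL2]; positivity
  set m := ⌈(D0 + 2) * L⌉₊ with hm
  have hm1 : (D0 + 2) * L ≤ m := Nat.le_ceil _
  have hm2 : (m:ℝ) < (D0 + 2) * L + 1 := Nat.ceil_lt_add_one (by positivity)
  have hm0 : m ≠ 0 := by
    have : (0:ℝ) < m := lt_of_lt_of_le (by positivity) hm1
    exact_mod_cast this.ne'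
  set σ := 2 * A / (d:ℝ)^2 with hσ
  have hσ0 : 0 ≤ σ := by positivity
  set X : (Fin d → ℝ) → MIdx d 2 → ℝ := fun g => auxX d (auxW d g) with hX
  set P := Measure.pi fun _ : Fin p => stdG (Fin d) with hP
  have hmom := aux_moment (stdG (Fin d)) X (auxX_bm d hd1) (auxX_norm d hd1) σ hσ0
    (aux_cov d hd1 A (hA d hd1)) p m 0 le_rfl Finset.univ
  simp only [zero_smul, zero_add, Finset.card_univ, Fintype.card_fin] at hmom
  set f : (Fin p → Fin d → ℝ) → ℝ := fun g => (auxS X Finset.univ g ^ m).trace with hf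
  have hfbm : AuxBM f := by
    have h1 : ∀ k l, AuxBM (fun g : Fin p → Fin d → ℝ => auxS X Finset.univ g k l) := by
      simpa using auxS_bm X (auxX_bm d hd1) (Finset.univ : Finset (Fin p)) 0
    exact AuxBM.sum _ fun k _ => auxBM_pow _ h1 m k k
  have hf0 : ∀ g, 0 ≤ f g := fun g => ((auxS_psd X Finset.univ g).pow m).trace_nonneg
  have hmarkov := mul_meas_ge_le_integral_of_nonneg (μ := P) (Filter.Eventually.of_forall hf0)
    (hfbm.integrable P) (t ^ m)
  -- numeric bound
  have hbase : (m:ℝ) + p * σ ≤ Real.exp (-1) * t := by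
    have h1 : (p:ℝ) * σ ≤ 2 * A * Mx := by
      have : (p:ℝ) * σ = 2 * A * (p / d^2) := by rw [hσ]; ring
      rw [this]; gcongr
    have h2 : (m:ℝ) ≤ (D0 + 3) * L * Mx := by
      have : (m:ℝ) ≤ (D0 + 3) * L := by linarith
      have h3 : (D0 + 3) * L * 1 ≤ (D0 + 3) * L * Mx := by gcongr
      linarith
    have h3 : 2 * A * Mx ≤ 2 * A * L * Mx := by
      have : 2 * A * 1 * Mx ≤ 2 * A * L * Mx := by gcongr
      linarith
    have h4 : B * L * Mx ≤ Real.exp (-1) * t := by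
      rw [ht, hL2, Real.exp_neg, ← div_eq_inv_mul, le_div_iff₀ (Real.exp_pos 1)]
      have : Real.exp 1 * B * (L * Mx) ≤ L * (L * Mx) := by gcongr
      linarith
    have h5 : B * L * Mx = (D0 + 3) * L * Mx + 2 * A * L * Mx := by rw [hB]; ring
    linarith
  have hcard : (Fintype.card (MIdx d 2) : ℝ) ≤ (d:ℝ)^2 := by exact_mod_cast aux_card d
  have hbad : P.real {g | t ^ m ≤ f g} ≤ (d:ℝ) ^ (-D0) := by
    have h1 : t ^ m * P.real {g | t ^ m ≤ f g} ≤ t ^ m * (d:ℝ) ^ (-D0) := by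
      refine hmarkov.trans (hmom.trans ?_)
      calc (Fintype.card (MIdx d 2) : ℝ) * (m + p * σ) ^ m ≤ (d:ℝ)^2 * (Real.exp (-1) * t) ^ m := by
            gcongr
        _ = t ^ m * ((d:ℝ)^(2:ℝ) * Real.exp (-m)) := by
            have e1 : Real.exp (-1) ^ m = Real.exp (-m) := by rw [← Real.exp_nat_mul]; congr 1; ring
            have e2 : (d:ℝ)^(2:ℝ) = (d:ℝ)^2 := by norm_cast
            rw [mul_pow, e1, e2]; ring
        _ ≤ t ^ m * (d:ℝ) ^ (-D0) := by
            rw [hdL, hdL, ← Real.exp_add]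
            gcongr
            linarith
    exact le_of_mul_le_mul_left h1 (by positivity)
  have hmap : (Measure.pi fun _ : Fin p => unifSphere (Fin d)) =
      P.map (fun g j => auxW d (g j)) := by
    haveI : IsProbabilityMeasure ((stdG (Fin d)).map (auxW d)) :=
      Measure.isProbabilityMeasure_map (auxW_meas d).aemeasurable
    exact (Measure.pi_map_pi (μ := fun _ : Fin p => stdG (Fin d)) (f := fun _ => auxW d)
      (fun _ => (auxW_meas d).aemeasurable)).symm
  rw [hmap]
  have hmeas : Measurable (fun (g : Fin p → Fin d → ℝ) (j : Fin p) => auxW d (g j)) :=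
    measurable_pi_lambda _ fun j => (auxW_meas d).comp (measurable_pi_apply j)
  refine le_trans ?_ (Measure.le_map_apply hmeas.aemeasurable _)
  have hms : MeasurableSet {g | t ^ m ≤ f g} := measurableSet_le measurable_const hfbm.1
  have hsub : {g | t ^ m ≤ f g}ᶜ ⊆ (fun (g : Fin p → Fin d → ℝ) (j : Fin p) => auxW d (g j)) ⁻¹'
      {w | (opNorm fun (j : Fin p) (κ : MIdx d 2) =>
                    qvec d 2 (w j) κ - (1 / (d : ℝ)) * eC d κ) ^ 2 ≤ t} := by
    intro g hg
    simp only [Set.mem_compl_iff, Set.mem_setOf_eq, not_le] at hg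
    exact aux_opNorm hd1 g m hm0 t ht0.le hg.le
  refine le_trans ?_ (measure_mono hsub)
  rw [prob_compl_eq_one_sub hms]
  refine tsub_le_tsub_left ?_ 1
  rw [← ofReal_measureReal]
  apply ENNReal.ofReal_le_ofReal
  refine hbad.trans ?_
  have : 1 ≤ Real.exp (D0 * (Real.exp 1 * B)) := Real.one_le_exp (by positivity)
  have h2 : 0 ≤ (d:ℝ) ^ (-D0) := by positivity
  nlinarith
end
end
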